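/- arXiv:1810.05802 — 6 statements merged into one kernel-verified Lean document; each statement's English description precedes it below -/
import Mathlib

section
/- If G is a C_{4k}-free bipartite graph, then the support of G and the core of G are disjoint: Supp(G) ∩ Core(G) = ∅. -/
open scoped Classical

namespace C4kPaper

open SimpleGraph

variable {V : Type*} [Fintype V] [DecidableEq V]

/-- The null space of the adjacency matrix of `G`, as a set of vectors. -/
noncomputable def nullSet (G : SimpleGraph V) : Set (V → ℝ) :=
  {x | Matrix.mulVec (G.adjMatrix ℝ) x = 0}

/-- The null space of the adjacency matrix of `G`, as a submodule of `ℝ^V`. -/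
noncomputable def nullModule (G : SimpleGraph V) : Submodule ℝ (V → ℝ) :=
  LinearMap.ker (G.adjMatrix ℝ).mulVecLin

/-- The nullity of `G`: the dimension of the null space of its adjacency matrix. -/
noncomputable def nullity (G : SimpleGraph V) : ℕ :=
  Module.finrank ℝ (nullModule G)

/-- The rank of the adjacency matrix of `G` over `ℝ`. -/
noncomputable def rk (G : SimpleGraph V) : ℕ :=
  (G.adjMatrix ℝ).rank

/-- The support of `G`: vertices where some null space vector is nonzero. -/
def supp (G : SimpleGraph V) : Set V :=
  {v | ∃ x ∈ nullSet G, x v ≠ 0}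

/-- The core of `G`: the neighbors of the support. -/
def core (G : SimpleGraph V) : Set V :=
  {u | ∃ v ∈ supp G, G.Adj u v}

/-- The N-part of `G`: vertices neither in the support nor in the core. -/
def npart (G : SimpleGraph V) : Set V :=
  (supp G ∪ core G)ᶜ

/-- `G` is bipartite. -/
def IsBipartite (G : SimpleGraph V) : Prop :=
  ∃ s : Set V, ∀ ⦃u v : V⦄, G.Adj u v → (u ∈ s ↔ v ∉ s)

/-- `G` has no cycle whose length is a multiple of 4. -/
def C4kFree (G : SimpleGraph V) : Prop :=
  ∀ (v : V) (c : G.Walk v v), c.IsCycle → ¬ (4 ∣ c.length)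

/-- `M` is a maximum matching of `G`. -/
def IsMaximumMatching (G : SimpleGraph V) (M : G.Subgraph) : Prop :=
  M.IsMatching ∧ ∀ M' : G.Subgraph, M'.IsMatching → M'.edgeSet.ncard ≤ M.edgeSet.ncard

/-- The matching number of `G`. -/
noncomputable def matchNum (G : SimpleGraph V) : ℕ :=
  sSup {n | ∃ M : G.Subgraph, M.IsMatching ∧ M.edgeSet.ncard = n}

/-- `s` is an independent set of `G`. -/
def IsIndep (G : SimpleGraph V) (s : Set V) : Prop :=
  ∀ ⦃u⦄, u ∈ s → ∀ ⦃w⦄, w ∈ s → ¬ G.Adj u w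

/-- `s` is a maximum independent set of `G`. -/
def IsMaxIndep (G : SimpleGraph V) (s : Set V) : Prop :=
  IsIndep G s ∧ ∀ t : Set V, IsIndep G t → t.ncard ≤ s.ncard

/-- The independence number of `G`. -/
noncomputable def indepNum (G : SimpleGraph V) : ℕ :=
  sSup {n | ∃ s : Set V, IsIndep G s ∧ s.ncard = n}

/-- An `(M,x)`-alternating walk `w₀, w₁, …, w_j` (here `w_i = p.getVert i`):
for all `0 ≤ i < ⌊(j-1)/2⌋`, `{w_{2i}, w_{2i+1}} ∈ M` and `x_{w_{2i}} · x_{w_{2i+2}} < 0`. -/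
def MxAltWalk (G : SimpleGraph V) (M : G.Subgraph) (x : V → ℝ) {v u : V}
    (p : G.Walk v u) : Prop :=
  ∀ i : ℕ, i < (p.length - 1) / 2 →
    M.Adj (p.getVert (2 * i)) (p.getVert (2 * i + 1)) ∧
      x (p.getVert (2 * i)) * x (p.getVert (2 * i + 2)) < 0

/-- A maximal `(M,x)`-alternating walk: one not properly contained in a longer
`(M,x)`-alternating walk from the same start. -/
def MaximalMxAltWalk (G : SimpleGraph V) (M : G.Subgraph) (x : V → ℝ) {v u : V}
    (p : G.Walk v u) : Prop :=
  MxAltWalk G M x p ∧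
    ∀ (u' : V) (q : G.Walk v u'), MxAltWalk G M x q → p.support <+: q.support →
      q.length = p.length

/-- An `M`-alternating walk starting with an edge not in `M`:
the `i`-th edge belongs to `M` iff `i` is odd. -/
def MAltWalk (G : SimpleGraph V) (M : G.Subgraph) {v u : V} (p : G.Walk v u) : Prop :=
  ∀ i : ℕ, i < p.length → (M.Adj (p.getVert i) (p.getVert (i + 1)) ↔ Odd i)

/-- Vertices reachable from `v` by an even-length `M`-alternating path. -/
def Re (G : SimpleGraph V) (M : G.Subgraph) (v : V) : Set V :=
  {u | ∃ p : G.Walk v u, p.IsPath ∧ MAltWalk G M p ∧ Even p.length}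

/-- Vertices reachable from `v` by an odd-length `M`-alternating path. -/
def Ro (G : SimpleGraph V) (M : G.Subgraph) (v : V) : Set V :=
  {u | ∃ p : G.Walk v u, p.IsPath ∧ MAltWalk G M p ∧ Odd p.length}


/-- A walk following a sequence of consecutively adjacent vertices. -/
lemma exists_walk_of_forall_adj {V : Type*} {G : SimpleGraph V} {s : ℕ → V}
    (hs : ∀ n, G.Adj (s n) (s (n + 1))) (k : ℕ) :
    ∃ p : G.Walk (s 0) (s k), p.length = k ∧ p.support = (List.range (k + 1)).map s := by
  induction k with
  | zero => exact ⟨.nil, by simp⟩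
  | succ k ih =>
    obtain ⟨p, hl, hp⟩ := ih
    refine ⟨p.concat (hs k), by simp [hl], ?_⟩
    rw [Walk.support_concat, hp, List.range_succ (n := k + 1)]
    simp

/-- If the vertices of a nonempty set carry labels in `ZMod 4` and each of them has a neighbour
in the set whose label is one larger, then there is a cycle of length divisible by four. -/
lemma exists_isCycle_four_dvd_length {V : Type*} [Finite V] {G : SimpleGraph V} (φ : V → ZMod 4)
    {S : Set V} (hne : S.Nonempty) (hS : ∀ a ∈ S, ∃ b ∈ S, G.Adj a b ∧ φ b = φ a + 1) :
    ∃ (v : V) (c : G.Walk v v), c.IsCycle ∧ 4 ∣ c.length := by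
  choose! f hfS hadj hφ using hS
  obtain ⟨a, ha⟩ := hne
  let s : ℕ → V := fun n => f^[n] a
  have hsucc (n : ℕ) : s (n + 1) = f (s n) := Function.iterate_succ_apply' f n a
  have hmem (n : ℕ) : s n ∈ S := by
    induction n with
    | zero => exact ha
    | succ n ih => rw [hsucc]; exact hfS _ ih
  have hsadj (n : ℕ) : G.Adj (s n) (s (n + 1)) := hsucc n ▸ hadj _ (hmem n)
  have hsφ (n k : ℕ) : φ (s (n + k)) = φ (s n) + k := by
    induction k with
    | zero => simp
    | succ k ih => rw [← add_assoc, hsucc, hφ _ (hmem _), ih]; push_cast; ring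
  have hex : ∃ k, ∃ i, 0 < k ∧ s i = s (i + k) := by
    obtain ⟨i, j, hij, h⟩ := Finite.exists_ne_map_eq_of_infinite s
    rcases lt_or_gt_of_ne hij with hlt | hlt
    · exact ⟨j - i, i, by lia, by rw [h]; congr 1; lia⟩
    · exact ⟨i - j, j, by lia, by rw [← h]; congr 1; lia⟩
  obtain ⟨i, hk, hi⟩ := Nat.find_spec hex
  have hmin (m : ℕ) (hm : m < Nat.find hex) (j : ℕ) (hm0 : 0 < m) : s j ≠ s (j + m) :=
    fun h => Nat.find_min hex hm ⟨j, hm0, h⟩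
  generalize Nat.find hex = k at hk hi hmin
  have hdvd : 4 ∣ k := by
    have h := hsφ i k
    rw [← hi, left_eq_add] at h
    exact (ZMod.natCast_eq_zero_iff k 4).1 h
  obtain ⟨p, hl, hp⟩ := exists_walk_of_forall_adj (s := fun n => s (i + 1 + n))
    (fun n => hsadj (i + 1 + n)) (k - 1)
  have hpath : p.IsPath := by
    rw [Walk.isPath_def, hp]
    refine List.Nodup.map_on (fun x hx y hy hxy => ?_) List.nodup_range
    rw [List.mem_range] at hx hy
    by_contra hne
    rcases lt_or_gt_of_ne hne with hlt | hlt
    · refine hmin (y - x) (by lia) (i + 1 + x) (by lia) (hxy.trans ?_)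
      congr 1; lia
    · refine hmin (x - y) (by lia) (i + 1 + y) (by lia) (hxy.symm.trans ?_)
      congr 1; lia
  have hend : s (i + 1 + (k - 1)) = s i := by
    rw [hi]; congr 1; lia
  refine ⟨s i, .cons (hsadj i) (p.copy rfl hend), ?_, ?_⟩
  · rw [Walk.cons_isCycle_iff]
    refine ⟨by simpa using hpath, fun he => ?_⟩
    have h1 := Walk.IsPath.length_eq_one_of_mem_edges (p := p.copy rfl hend) (by simpa using hpath)
      (by rw [Sym2.eq_swap]; exact he)
    rw [Walk.length_copy] at h1
    lia
  · rw [Walk.length_cons, Walk.length_copy, hl]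
    rwa [Nat.sub_add_cancel hk]

omit [DecidableEq V] in
lemma mem_nullSet_iff {G : SimpleGraph V} {x : V → ℝ} :
    x ∈ nullSet G ↔ ∀ b, ∑ c ∈ G.neighborFinset b, x c = 0 := by
  simp [nullSet, funext_iff, adjMatrix_mulVec_apply]

omit [DecidableEq V] in
/-- If a null vector is nonzero at a neighbour of `b`, it has the opposite sign at another one. -/
lemma exists_adj_mul_neg {G : SimpleGraph V} {x : V → ℝ} (hx : x ∈ nullSet G) {a b : V}
    (hab : G.Adj b a) (ha : x a ≠ 0) : ∃ c, G.Adj b c ∧ x a * x c < 0 := by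
  by_contra! h
  have hsum : ∑ c ∈ G.neighborFinset b, x a * x c = 0 := by
    rw [← Finset.mul_sum, mem_nullSet_iff.1 hx, mul_zero]
  rw [Finset.sum_eq_zero_iff_of_nonneg fun c hc => h c (by simpa using hc)] at hsum
  exact ha (mul_self_eq_zero.1 (hsum a (by simpa using hab)))

omit [DecidableEq V] in
/-- Null vectors of a bipartite graph can be combined from different parts. -/
lemma piecewise_mem_nullSet {G : SimpleGraph V} {s : Set V}
    (hs : ∀ ⦃u v : V⦄, G.Adj u v → (u ∈ s ↔ v ∉ s)) {x y : V → ℝ}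
    (hx : x ∈ nullSet G) (hy : y ∈ nullSet G) : s.piecewise x y ∈ nullSet G := by
  rw [mem_nullSet_iff] at *
  intro b
  by_cases hb : b ∈ s
  · rw [← hy b]
    refine Finset.sum_congr rfl fun c hc => Set.piecewise_eq_of_notMem _ _ _ ?_
    exact (hs (by simpa using hc)).1 hb
  · rw [← hx b]
    refine Finset.sum_congr rfl fun c hc => Set.piecewise_eq_of_mem _ _ _ ?_
    exact not_not.1 fun h => hb ((hs (by simpa using hc)).2 h)

omit [DecidableEq V] in
/-- In a `C_{4k}`-free bipartite graph, a null vector does not take nonzero values at both ends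
of an edge. -/
lemma eq_zero_of_adj_of_mem_nullSet {G : SimpleGraph V} (hb : IsBipartite G) (hc : C4kFree G)
    {w : V → ℝ} (hw : w ∈ nullSet G) {u v : V} (huv : G.Adj u v) (hu : w u ≠ 0) : w v = 0 := by
  by_contra hv
  obtain ⟨s, hs⟩ := hb
  let φ : V → ZMod 4 := fun a =>
    if a ∈ s then (if 0 < w a then 0 else 2) else (if 0 < w a then 1 else 3)
  let S : Set V := {b | ∃ a, G.Adj a b ∧ w a ≠ 0 ∧ w b ≠ 0 ∧ φ b = φ a + 1}
  have hne : S.Nonempty := by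
    have h : φ v = φ u + 1 ∨ φ u = φ v + 1 := by
      have := hs huv
      simp only [φ]
      split_ifs <;> first | decide | tauto
    rcases h with h | h
    · exact ⟨v, u, huv, hu, hv, h⟩
    · exact ⟨u, v, huv.symm, hv, hu, h⟩
  obtain ⟨x, c, hcyc, hdvd⟩ := exists_isCycle_four_dvd_length (G := G) φ hne <| by
    rintro b ⟨a, hab, ha, hb, hφ⟩
    obtain ⟨c, hbc, hlt⟩ := exists_adj_mul_neg hw hab.symm ha
    have hcb : φ c = φ b + 1 := by
      have hside : a ∈ s ↔ c ∈ s := by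
        have h1 := hs hab
        have h2 := hs hbc
        tauto
      have hac : φ c = φ a + 2 := by
        rcases mul_neg_iff.1 hlt with ⟨h1, h2⟩ | ⟨h1, h2⟩ <;> by_cases h : c ∈ s <;>
          simp [φ, hside, h, h1, h2, h1.not_gt, h2.not_gt] <;> decide
      rw [hac, hφ, add_assoc, one_add_one_eq_two]
    exact ⟨c, ⟨b, hbc, hb, right_ne_zero_of_mul hlt.ne, hcb⟩, hbc, hcb⟩
  exact hc x c hcyc hdvd

/-- the support and the core of a `C_{4k}`-free bipartite graph are disjoint. -/
theorem stmt4 (G : SimpleGraph V) (hb : IsBipartite G) (hc : C4kFree G) :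
    supp G ∩ core G = ∅ := by
  rw [Set.eq_empty_iff_forall_notMem]
  rintro u ⟨⟨x, hx, hxu⟩, v, ⟨y, hy, hyv⟩, huv⟩
  obtain ⟨s, hs⟩ := id hb
  by_cases hu : u ∈ s
  · have hv : v ∉ s := (hs huv).1 hu
    have := eq_zero_of_adj_of_mem_nullSet hb hc (piecewise_mem_nullSet hs hx hy) huv
    simp_all
  · have hv : v ∈ s := not_not.1 fun h => hu ((hs huv).2 h)
    have := eq_zero_of_adj_of_mem_nullSet hb hc (piecewise_mem_nullSet hs hy hx) huv
    simp_all

end C4kPaper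
end

section
/- Let G be a C_{4k}-free bipartite graph and M a maximum matching of G. Then the set of vertices reachable from M-unsaturated vertices by even-length M-alternating paths equals Supp(G), and the set reachable by odd-length M-alternating paths equals Core(G). -/
open scoped Classical

namespace C4kPaper

open SimpleGraph

variable {V : Type*} [Fintype V] [DecidableEq V]

section Parity

variable {V : Type*} {G : SimpleGraph V} {s : Set V}

lemma getVert_mem_side_iff (hs : ∀ ⦃u v : V⦄, G.Adj u v → (u ∈ s ↔ v ∉ s)) {u v : V}
    (p : G.Walk u v) (k : ℕ) (hk : k ≤ p.length) :
    p.getVert k ∈ s ↔ (u ∈ s ↔ Even k) := by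
  induction k with
  | zero => simp
  | succ k ih =>
    have h1 := hs (p.adj_getVert_succ (i := k) (by omega))
    have h2 := ih (by omega)
    rw [Nat.even_add_one]
    tauto

lemma exists_walk_of_forall_adj_s9 (h : ℕ → V) (hadj : ∀ k, G.Adj (h k) (h (k + 1))) (a n : ℕ) :
    ∃ p : G.Walk (h a) (h (a + n)), p.length = n ∧ ∀ k ≤ n, p.getVert k = h (a + k) := by
  induction n with
  | zero => exact ⟨Walk.nil, rfl, fun k hk => by simp [Nat.le_zero.mp hk]⟩
  | succ n ih =>
    obtain ⟨p, hp, hv⟩ := ih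
    refine ⟨p.concat (hadj (a + n)), by simp [hp], fun k hk => ?_⟩
    rw [Walk.concat_eq_append, Walk.getVert_append]
    split_ifs with hlt
    · exact hv k (by omega)
    · have : k = n ∨ k = n + 1 := by omega
      rcases this with rfl | rfl
      · simp [hp]
      · simp [hp, ← add_assoc]

lemma exists_isCycle_of_forall_adj (h : ℕ → V) (hadj : ∀ k, G.Adj (h k) (h (k + 1)))
    {a n : ℕ} (hn : 3 ≤ n) (heq : h (a + n) = h a)
    (hinj : ∀ k < n, ∀ l < n, h (a + k) = h (a + l) → k = l) :
    ∃ c : G.Walk (h a) (h a), c.IsCycle ∧ c.length = n := by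
  obtain ⟨p, hp, hv⟩ := exists_walk_of_forall_adj_s9 h hadj a n
  have key : ∀ {x : V} (p : G.Walk (h a) x) (hx : x = h a), p.length = n →
      (∀ k ≤ n, p.getVert k = h (a + k)) →
      ∃ c : G.Walk (h a) (h a), c.IsCycle ∧ c.length = n := by
    rintro x p rfl hp hv
    refine ⟨p, ?_, hp⟩
    rw [Walk.isCycle_iff_isPath_tail_and_le_length]
    refine ⟨?_, by omega⟩
    rw [← Walk.IsPath.getVert_injOn_iff]
    have hl := Walk.length_tail_add_one (p := p)
      (by rw [← Walk.length_eq_zero_iff]; omega)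
    intro k hk l hl' hkl
    simp only [Set.mem_ofPred_eq] at hk hl'
    rw [Walk.getVert_tail, Walk.getVert_tail, hv _ (by omega), hv _ (by omega)] at hkl
    by_cases hk1 : k + 1 = n
    · by_cases hl1 : l + 1 = n
      · omega
      · rw [hk1, heq] at hkl
        have := hinj 0 (by omega) (l + 1) (by omega) hkl
        omega
    · by_cases hl1 : l + 1 = n
      · rw [hl1, heq] at hkl
        have := hinj (k + 1) (by omega) 0 (by omega) hkl
        omega
      · have := hinj (k + 1) (by omega) (l + 1) (by omega) hkl
        omega
  exact key p heq hp hv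

lemma pos_of_forall_mul_neg (y : ℕ → ℝ) (hy : ∀ n, y n * y (n + 1) < 0) (i n : ℕ) :
    0 < (-1) ^ n * (y i * y (i + n)) := by
  induction n with
  | zero =>
    have : y i ≠ 0 := fun h => by simpa [h] using hy i
    simpa using mul_self_pos.mpr this
  | succ n ih =>
    have h1 := hy (i + n)
    have h2 : 0 < y (i + n) ^ 2 := by
      have : y (i + n) ≠ 0 := fun h => by simp [h] at h1
      positivity
    have h3 := mul_pos ih (neg_pos.mpr h1)
    refine pos_of_mul_pos_left (b := y (i + n) ^ 2) ?_ h2.le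
    rw [← add_assoc, pow_succ]
    linarith

/-- In a finite bipartite graph without cycles of length divisible by four, no nonempty set of
vertices is closed under a sign-changing step along a matching edge and then another edge. -/
lemma not_exists_alternating_step_closed [Finite V] (hb : IsBipartite G) (hc : C4kFree G)
    {M : G.Subgraph} (hM : M.IsMatching) (y : V → ℝ) (T : Set V) (hT : T.Nonempty)
    (hstep : ∀ w ∈ T, ∃ g w', M.Adj w g ∧ G.Adj g w' ∧ w' ∈ T ∧ y w * y w' < 0) : False := by
  obtain ⟨s, hs⟩ := hb
  obtain ⟨w₀, hw₀⟩ := hT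
  choose! g n hg hn hnT hy using hstep
  let f : ℕ → V := fun k => n^[k] w₀
  have hf : ∀ k, f (k + 1) = n (f k) := fun k => Function.iterate_succ_apply' n k w₀
  have hfT : ∀ k, f k ∈ T := by
    intro k
    induction k with
    | zero => exact hw₀
    | succ k ih => rw [hf]; exact hnT _ ih
  have hside : ∀ k, (f k ∈ s ↔ w₀ ∈ s) := by
    intro k
    induction k with
    | zero => rfl
    | succ k ih =>
      rw [hf]
      have h1 := hs (hg _ (hfT k)).adj_sub
      have h2 := hs (hn _ (hfT k))
      tauto
  have hfg : ∀ k l, f k ≠ g (f l) := by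
    intro k l h
    have h1 := hs (hg _ (hfT l)).adj_sub
    rw [← h, hside, hside] at h1
    tauto
  have hrep : ∃ j, ∃ i < j, f i = f j := by
    obtain ⟨i, j, hij, h⟩ := Finite.exists_ne_map_eq_of_infinite f
    rcases lt_or_gt_of_ne hij with h' | h'
    · exact ⟨j, i, h', h⟩
    · exact ⟨i, j, h', h.symm⟩
  classical
  obtain ⟨i, hij, hfij⟩ := Nat.find_spec hrep
  have hmin := fun {m} => Nat.find_min (m := m) hrep
  generalize Nat.find hrep = j at hij hfij hmin
  have hinj : ∀ a < j, ∀ b < j, f a = f b → a = b := by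
    intro a ha b hb h
    rcases lt_trichotomy a b with h' | h' | h'
    · exact absurd ⟨a, h', h⟩ (hmin hb)
    · exact h'
    · exact absurd ⟨b, h', h.symm⟩ (hmin ha)
  have hinjg : ∀ a < j, ∀ b < j, g (f a) = g (f b) → a = b := by
    intro a ha b hb h
    refine hinj a ha b hb (hM.eq_of_adj_right (hg _ (hfT a)) ?_)
    rw [h]
    exact hg _ (hfT b)
  obtain ⟨m, rfl⟩ := Nat.exists_eq_add_of_lt hij
  have heven : Even (m + 1) := by
    by_contra hodd
    rw [Nat.not_even_iff_odd] at hodd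
    have := pos_of_forall_mul_neg (fun k => y (f k))
      (fun k => by simpa only [hf] using hy _ (hfT k)) i (m + 1)
    simp only [hodd.neg_one_pow, ← add_assoc, ← hfij] at this
    nlinarith [mul_self_nonneg (y (f i))]
  let h : ℕ → V := fun k => if Even k then f (k / 2) else g (f (k / 2))
  have h_even : ∀ k, h (2 * k) = f k := fun k => by simp [h]
  have h_odd : ∀ k, h (2 * k + 1) = g (f k) := fun k => by
    have : (2 * k + 1) / 2 = k := by omega
    simp [h, this]
  have hadj : ∀ k, G.Adj (h k) (h (k + 1)) := by
    intro k
    rcases Nat.even_or_odd' k with ⟨l, rfl | rfl⟩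
    · rw [h_even, h_odd]
      exact (hg _ (hfT l)).adj_sub
    · rw [h_odd, show 2 * l + 1 + 1 = 2 * (l + 1) by ring, h_even, hf]
      exact hn _ (hfT l)
  obtain ⟨r, hr⟩ := heven
  obtain ⟨c, hcyc, hlen⟩ := exists_isCycle_of_forall_adj h hadj (a := 2 * i) (n := 2 * (m + 1))
    (by omega) (by rw [← mul_add, h_even, h_even, ← add_assoc, hfij]) (by
      intro k hk l hl hkl
      rcases Nat.even_or_odd' k with ⟨k, rfl | rfl⟩ <;>
        rcases Nat.even_or_odd' l with ⟨l, rfl | rfl⟩ <;>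
        simp only [← add_assoc, ← mul_add, h_even, h_odd] at hkl
      · have := hinj _ (by omega) _ (by omega) hkl
        omega
      · exact absurd hkl (hfg _ _)
      · exact absurd hkl.symm (hfg _ _)
      · have := hinjg _ (by omega) _ (by omega) hkl
        omega)
  exact hc _ c hcyc ⟨r, by omega⟩

end Parity

section Reachability

variable {V : Type*} {G : SimpleGraph V} {M : G.Subgraph}

lemma MAltWalk.take {u v : V} {p : G.Walk u v} (hp : MAltWalk G M p) (k : ℕ) :
    MAltWalk G M (p.take k) := by
  intro i hi
  rw [Walk.take_length] at hi
  rw [Walk.take_getVert, Walk.take_getVert, min_eq_right (by omega), min_eq_right (by omega)]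
  exact hp i (by omega)

lemma MAltWalk.concat {u v w : V} {p : G.Walk u v} (hp : MAltWalk G M p) (h : G.Adj v w)
    (hM : M.Adj v w ↔ Odd p.length) : MAltWalk G M (p.concat h) := by
  intro i hi
  rw [Walk.length_concat] at hi
  rw [Walk.concat_eq_append, Walk.getVert_append, Walk.getVert_append]
  by_cases h1 : i + 1 < p.length
  · rw [if_pos (by omega), if_pos h1]
    exact hp i (by omega)
  · by_cases h2 : i + 1 = p.length
    · rw [if_pos (by omega), if_neg h1, h2]
      have := hp i (by omega)
      rw [h2, Walk.getVert_length] at this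
      simpa using this
    · obtain rfl : i = p.length := by omega
      simpa using hM

lemma getVert_mem_Re {u v : V} {p : G.Walk u v} (hp : p.IsPath) (hpM : MAltWalk G M p) {k : ℕ}
    (hk : k ≤ p.length) (he : Even k) : p.getVert k ∈ Re G M u :=
  ⟨p.take k, hp.take k, hpM.take k, by rwa [Walk.take_length, min_eq_left hk]⟩

lemma getVert_mem_Ro {u v : V} {p : G.Walk u v} (hp : p.IsPath) (hpM : MAltWalk G M p) {k : ℕ}
    (hk : k ≤ p.length) (ho : Odd k) : p.getVert k ∈ Ro G M u :=
  ⟨p.take k, hp.take k, hpM.take k, by rwa [Walk.take_length, min_eq_left hk]⟩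

lemma self_mem_Re (u : V) : u ∈ Re G M u :=
  ⟨Walk.nil, Walk.IsPath.nil, fun i hi => by simp at hi, by simp⟩

lemma mem_side_iff_of_mem_Re {s : Set V} (hs : ∀ ⦃u v : V⦄, G.Adj u v → (u ∈ s ↔ v ∉ s))
    {u v : V} (hv : v ∈ Re G M u) : v ∈ s ↔ u ∈ s := by
  obtain ⟨p, -, -, he⟩ := hv
  have := getVert_mem_side_iff hs p p.length le_rfl
  rw [Walk.getVert_length] at this
  tauto

lemma mem_Re_of_adj_of_adj (hb : IsBipartite G) (hM : M.IsMatching) {u a g w : V}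
    (ha : a ∈ Re G M u) (hag : G.Adj a g) (hgw : M.Adj g w) : w ∈ Re G M u := by
  by_cases haw : a = w
  · exact haw ▸ ha
  obtain ⟨s, hs⟩ := hb
  have hside := mem_side_iff_of_mem_Re hs ha
  obtain ⟨p, hp, hpM, he⟩ := ha
  have h1 := hs hag
  have h2 := hs hgw.adj_sub
  by_cases hg : g ∈ p.support
  · obtain ⟨k, rfl, hk⟩ := Walk.mem_support_iff_exists_getVert.mp hg
    have h3 := getVert_mem_side_iff hs p k hk
    have hodd : Odd k := by
      rw [← Nat.not_even_iff_odd]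
      tauto
    have hlt : k < p.length := lt_of_le_of_ne hk fun h => by
      rw [h, ← Nat.not_even_iff_odd] at hodd
      exact hodd he
    rw [← hM.eq_of_adj_left ((hpM k hlt).mpr hodd) hgw]
    exact getVert_mem_Re hp hpM hlt hodd.add_one
  by_cases hw : w ∈ p.support
  · obtain ⟨k, rfl, hk⟩ := Walk.mem_support_iff_exists_getVert.mp hw
    have h3 := getVert_mem_side_iff hs p k hk
    exact getVert_mem_Re hp hpM hk (by tauto)
  have hnot : ¬ M.Adj a g := fun h => haw (hM.eq_of_adj_right h hgw.symm)
  refine ⟨(p.concat hag).concat hgw.adj_sub, (hp.concat hg hag).concat ?_ _,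
    (hpM.concat hag ?_).concat _ ?_, ?_⟩
  · rw [Walk.support_concat]
    simp only [List.mem_append, List.mem_singleton, not_or]
    exact ⟨hw, hgw.adj_sub.ne'⟩
  · simp [hnot, he]
  · simp [hgw, he.add_one]
  · simp only [Walk.length_concat, add_assoc]
    exact he.add even_two

lemma mem_Ro_of_adj (hb : IsBipartite G) (hM : M.IsMatching) {u a w : V} (hu : u ∉ M.verts)
    (ha : a ∈ Re G M u) (haw : G.Adj a w) : w ∈ Ro G M u := by
  obtain ⟨s, hs⟩ := hb
  have hside := mem_side_iff_of_mem_Re hs ha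
  obtain ⟨p, hp, hpM, he⟩ := ha
  have h1 := hs haw
  by_cases hw : w ∈ p.support
  · obtain ⟨k, rfl, hk⟩ := Walk.mem_support_iff_exists_getVert.mp hw
    have h3 := getVert_mem_side_iff hs p k hk
    refine getVert_mem_Ro hp hpM hk ?_
    rw [← Nat.not_even_iff_odd]
    tauto
  refine ⟨p.concat haw, hp.concat hw haw, hpM.concat haw ?_, ?_⟩
  · refine iff_of_false (fun h => ?_) (by rwa [Nat.not_odd_iff_even])
    rcases Nat.eq_zero_or_pos p.length with h0 | h0
    · exact hu (Walk.eq_of_length_eq_zero h0 ▸ h.fst_mem)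
    · have h2 := (hpM (p.length - 1) (by omega)).mpr (Nat.Even.sub_odd h0 he odd_one)
      rw [Nat.sub_add_cancel h0, Walk.getVert_length] at h2
      rw [hM.eq_of_adj_left h h2.symm] at hw
      exact hw (Walk.getVert_mem_support _ _)
  · rw [Walk.length_concat]
    exact he.add_one

lemma exists_mem_Re_of_mem_Ro {u w : V} (hw : w ∈ Ro G M u) :
    ∃ a ∈ Re G M u, G.Adj w a := by
  obtain ⟨p, hp, hpM, ho⟩ := hw
  have h0 := ho.pos
  refine ⟨_, getVert_mem_Re hp hpM (Nat.sub_le p.length 1) (Nat.Odd.sub_odd ho odd_one), ?_⟩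
  have := p.adj_getVert_succ (i := p.length - 1) (by omega)
  rw [Nat.sub_add_cancel h0, Walk.getVert_length] at this
  exact this.symm

end Reachability

section Exchange

variable {V : Type*} {G : SimpleGraph V}

/-- The matching obtained from `M` by removing the edge at `c` and adding the edge `ub`. -/
def exchange (M : G.Subgraph) {u b : V} (hub : G.Adj u b) (c : V) (hc : c ≠ b) (hb : b ∈ M.verts) :
    G.Subgraph where
  verts := insert u (M.verts \ {c})
  Adj x y := (M.Adj x y ∧ x ≠ c ∧ y ≠ c) ∨ (x = u ∧ y = b) ∨ (x = b ∧ y = u)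
  adj_sub := by
    rintro x y (h | ⟨rfl, rfl⟩ | ⟨rfl, rfl⟩)
    · exact h.1.adj_sub
    · exact hub
    · exact hub.symm
  edge_vert := by
    rintro x y (h | ⟨rfl, rfl⟩ | ⟨rfl, rfl⟩)
    · exact Or.inr ⟨h.1.fst_mem, h.2.1⟩
    · exact Or.inl rfl
    · exact Or.inr ⟨hb, hc.symm⟩
  symm := ⟨by
    rintro x y (h | h | h)
    · exact Or.inl ⟨h.1.symm, h.2.2, h.2.1⟩
    · exact Or.inr (Or.inr h.symm)
    · exact Or.inr (Or.inl h.symm)⟩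

lemma exists_isMaximumMatching_exchange [Finite V] {M : G.Subgraph} (hM : IsMaximumMatching G M)
    {u b c : V} (hu : u ∉ M.verts) (hub : G.Adj u b) (hbc : M.Adj b c) :
    ∃ M' : G.Subgraph, IsMaximumMatching G M' ∧ M'.verts = insert u (M.verts \ {c}) ∧
      ∀ x y, M'.Adj x y ↔ (M.Adj x y ∧ x ≠ c ∧ y ≠ c) ∨ (x = u ∧ y = b) ∨ (x = b ∧ y = u) := by
  have hbne : b ≠ u := hub.ne'
  have hcu : c ≠ u := fun h => hu (h ▸ hbc.snd_mem)
  have hcb : c ≠ b := hbc.adj_sub.ne'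
  refine ⟨exchange M hub c hcb hbc.fst_mem, ⟨?_, ?_⟩, rfl, fun _ _ => Iff.rfl⟩
  · rintro v (rfl | ⟨hv, hvc⟩)
    · refine ⟨b, Or.inr (Or.inl ⟨rfl, rfl⟩), ?_⟩
      rintro y (h | h | h)
      · exact absurd h.1.fst_mem hu
      · exact h.2
      · exact absurd h.1.symm hbne
    · by_cases hvb : v = b
      · subst hvb
        refine ⟨u, Or.inr (Or.inr ⟨rfl, rfl⟩), ?_⟩
        rintro y (h | h | h)
        · exact absurd (hM.1.eq_of_adj_left h.1 hbc) h.2.2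
        · exact absurd h.1 hbne
        · exact h.2
      · obtain ⟨w, hw, huniq⟩ := hM.1 hv
        refine ⟨w, Or.inl ⟨hw, hvc, ?_⟩, ?_⟩
        · rintro rfl
          exact hvb (hM.1.eq_of_adj_right hw hbc)
        · rintro y (h | h | h)
          · exact huniq y h.1
          · exact absurd (h.1 ▸ hv) hu
          · exact absurd h.1 hvb
  · intro N hN
    refine (hM.2 N hN).trans (le_of_eq ?_)
    have hedge : (exchange M hub c hcb hbc.fst_mem).edgeSet =
        insert s(u, b) (M.edgeSet \ {s(b, c)}) := by
      ext e
      induction e using Sym2.ind with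
      | _ x y =>
        simp only [Subgraph.mem_edgeSet, Set.mem_insert_iff, Set.mem_sdiff, Set.mem_singleton_iff,
          Sym2.eq_iff]
        change (M.Adj x y ∧ x ≠ c ∧ y ≠ c) ∨ (x = u ∧ y = b) ∨ (x = b ∧ y = u) ↔ _
        have h1 : M.Adj x y → x = c → y = b := by
          rintro h rfl
          exact hM.1.eq_of_adj_left h hbc.symm
        have h2 : M.Adj x y → y = c → x = b := by
          rintro h rfl
          exact hM.1.eq_of_adj_right h hbc
        tauto
    rw [hedge, Set.ncard_exchange (fun h => hu (Subgraph.mem_edgeSet.mp h).fst_mem)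
      (Subgraph.mem_edgeSet.mpr hbc)]

lemma not_adj_of_notMem_verts [Finite V] {M : G.Subgraph} (hM : IsMaximumMatching G M) {a w : V}
    (ha : a ∉ M.verts) (hw : w ∉ M.verts) : ¬ G.Adj a w := by
  intro haw
  have hmatch : (M ⊔ G.subgraphOfAdj haw).IsMatching := by
    refine hM.1.sup (Subgraph.IsMatching.subgraphOfAdj haw) ?_
    rw [Set.disjoint_left]
    intro x hx hx'
    have h1 := M.support_subset_verts hx
    have h2 := (G.subgraphOfAdj haw).support_subset_verts hx'
    rcases h2 with rfl | rfl
    · exact ha h1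
    · exact hw h1
  have := hM.2 _ hmatch
  rw [Subgraph.edgeSet_sup, edgeSet_subgraphOfAdj, Set.union_singleton,
    Set.ncard_insert_of_notMem (fun h => ha (Subgraph.mem_edgeSet.mp h).fst_mem)] at this
  omega

lemma exists_isMaximumMatching_of_mem_Re [Finite V] {u v : V} {M : G.Subgraph}
    (hM : IsMaximumMatching G M) (hu : u ∉ M.verts) (hv : v ∈ Re G M u) :
    ∃ M' : G.Subgraph, IsMaximumMatching G M' ∧ v ∉ M'.verts ∧
      ∀ z, z ∉ M.verts → z ≠ u → z ∉ M'.verts := by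
  obtain ⟨p, hp, hpM, he⟩ := hv
  obtain ⟨n, hn⟩ : ∃ n, p.length = n := ⟨_, rfl⟩
  induction n using Nat.strong_induction_on generalizing u M with
  | _ n ih =>
    match p, hp, hpM, he, hn with
    | .nil, _, _, _, _ => exact ⟨M, hM, hu, fun z hz _ => hz⟩
    | .cons _ .nil, _, _, he, _ => simp at he
    | .cons (v := b) hub (.cons (v := c) hbc q), hp, hpM, he, hn =>
      have hMbc : M.Adj b c := by simpa using hpM 1 (by simp)
      obtain ⟨M', hM', hverts, hadj⟩ := exists_isMaximumMatching_exchange hM hu hub hMbc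
      have hcu : c ≠ u := fun h => hu (h ▸ hMbc.snd_mem)
      rw [Walk.cons_isPath_iff, Walk.cons_isPath_iff] at hp
      obtain ⟨⟨hq, hbq⟩, huq⟩ := hp
      rw [Walk.support_cons, List.mem_cons, not_or] at huq
      have hne_b : ∀ i, q.getVert i ≠ b := fun i h => hbq (h ▸ q.getVert_mem_support i)
      have hne_u : ∀ i, q.getVert i ≠ u := fun i h => huq.2 (h ▸ q.getVert_mem_support i)
      have hne_c : ∀ i, 0 < i → i ≤ q.length → q.getVert i ≠ c := by
        intro i hi hil h
        have := hq.getVert_injOn (x₁ := i) (x₂ := 0) hil (Nat.zero_le _) (by simpa using h)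
        omega
      have hcM' : c ∉ M'.verts := by simp [hverts, hcu]
      have hqM : MAltWalk G M' q := by
        intro i hi
        rcases Nat.eq_zero_or_pos i with rfl | hi0
        · rw [Walk.getVert_zero]
          exact iff_of_false (fun h => hcM' h.fst_mem) (by simp)
        · have h1 := hpM (i + 2) (by simpa using hi)
          simp only [Walk.getVert_cons_succ] at h1
          rw [hadj]
          have h2 : Odd (i + 2) ↔ Odd i := by simp [Nat.odd_add]
          simp [h1, h2, hne_b, hne_u, hne_c i hi0 hi.le, hne_c (i + 1) (by omega) hi]
      simp only [Walk.length_cons, add_assoc] at he hn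
      obtain ⟨M'', hM'', hv'', hz''⟩ := ih q.length (by omega) hM' hcM' q hq hqM
        (by simpa [Nat.even_add] using he) rfl
      refine ⟨M'', hM'', hv'', fun z hz hzu => hz'' z ?_ ?_⟩
      · simp [hverts, hzu, hz]
      · rintro rfl
        exact hz hMbc.snd_mem

lemma mem_verts_of_adj_of_mem_Re [Finite V] (hb : IsBipartite G) {u a w : V} {M : G.Subgraph}
    (hM : IsMaximumMatching G M) (hu : u ∉ M.verts) (ha : a ∈ Re G M u) (haw : G.Adj a w) :
    w ∈ M.verts := by
  by_contra hw
  obtain ⟨M', hM', haM', hM'z⟩ := exists_isMaximumMatching_of_mem_Re hM hu ha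
  refine not_adj_of_notMem_verts hM' haM' (hM'z w hw ?_) haw
  rintro rfl
  obtain ⟨s, hs⟩ := hb
  have h1 := mem_side_iff_of_mem_Re hs ha
  have h2 := hs haw
  tauto

end Exchange

section Support

variable {V : Type*}

lemma exists_mul_neg_of_sum_eq_zero {t : Finset V} {y : V → ℝ} (hsum : ∑ i ∈ t, y i = 0) {w : V}
    (hw : w ∈ t) (hy : y w ≠ 0) : ∃ w' ∈ t, y w * y w' < 0 := by
  by_contra! h
  have h0 : ∑ i ∈ t, y w * y i = 0 := by rw [← Finset.mul_sum, hsum, mul_zero]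
  have := (Finset.sum_eq_zero_iff_of_nonneg h).mp h0 w hw
  exact hy (mul_self_eq_zero.mp this)

lemma exists_forall_sum_neighbor_of_notMem_supp [Fintype V] [DecidableEq V] {G : SimpleGraph V} {v : V}
    (hv : v ∉ supp G) :
    ∃ y : V → ℝ, ∀ w, ∑ i ∈ G.neighborFinset w, y i = if w = v then 1 else 0 := by
  have hmem : (LinearMap.proj v : (V → ℝ) →ₗ[ℝ] ℝ) ∈
      LinearMap.range (G.adjMatrix ℝ).mulVecLin.dualMap := by
    rw [LinearMap.range_dualMap_eq_dualAnnihilator_ker, Submodule.mem_dualAnnihilator]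
    intro x hx
    by_contra h
    exact hv ⟨x, by simpa [nullSet] using hx, h⟩
  obtain ⟨φ, hφ⟩ := hmem
  refine ⟨fun i => φ (Pi.single i 1), fun w => ?_⟩
  have h1 := LinearMap.congr_fun hφ (Pi.single w 1)
  rw [LinearMap.dualMap_apply, LinearMap.proj_apply, Matrix.mulVecLin_apply,
    Matrix.mulVec_single_one] at h1
  have h2 : (G.adjMatrix ℝ).col w = ∑ i ∈ G.neighborFinset w, Pi.single i (1 : ℝ) := by
    ext i
    simp [Matrix.col_apply, SimpleGraph.adjMatrix_apply, Finset.sum_apply, Pi.single_apply,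
      G.adj_comm]
  rw [h2, map_sum] at h1
  rw [h1, Pi.single_apply]
  simp [eq_comm]

variable [Fintype V] {G : SimpleGraph V} {M : G.Subgraph}

lemma exists_mem_Re_of_mem_supp (hb : IsBipartite G) (hc : C4kFree G) (hM : M.IsMatching) {v : V}
    (hv : v ∈ supp G) : ∃ u, u ∉ M.verts ∧ v ∈ Re G M u := by
  obtain ⟨x, hx, hxv⟩ := hv
  by_contra hcon
  refine not_exists_alternating_step_closed hb hc hM x
    {w | x w ≠ 0 ∧ ¬ ∃ u, u ∉ M.verts ∧ w ∈ Re G M u} ⟨v, hxv, hcon⟩ ?_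
  rintro w ⟨hxw, hw⟩
  have hwM : w ∈ M.verts := by
    by_contra h
    exact hw ⟨w, h, self_mem_Re w⟩
  obtain ⟨g, hg, -⟩ := hM hwM
  have hsum : ∑ i ∈ G.neighborFinset g, x i = 0 := by
    rw [← SimpleGraph.adjMatrix_mulVec_apply]
    exact congrFun hx g
  obtain ⟨w', hw', hneg⟩ := exists_mul_neg_of_sum_eq_zero hsum
    (by simpa using hg.adj_sub.symm) hxw
  rw [SimpleGraph.mem_neighborFinset] at hw'
  refine ⟨g, w', hg, hw', ⟨fun h => by simp [h] at hneg, ?_⟩, hneg⟩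
  rintro ⟨u, hu, hmem⟩
  exact hw ⟨u, hu, mem_Re_of_adj_of_adj hb hM hmem hw'.symm hg.symm⟩

lemma mem_supp_of_notMem_verts [DecidableEq V] (hb : IsBipartite G) (hc : C4kFree G)
    (hM : IsMaximumMatching G M) {v : V} (hv : v ∉ M.verts) : v ∈ supp G := by
  by_contra hcon
  obtain ⟨y, hy⟩ := exists_forall_sum_neighbor_of_notMem_supp hcon
  refine not_exists_alternating_step_closed hb hc hM.1 y
    {w | y w ≠ 0 ∧ ∃ a ∈ Re G M v, G.Adj a w} ?_ ?_
  · obtain ⟨w, hw, hyw⟩ := Finset.exists_ne_zero_of_sum_ne_zero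
      (s := G.neighborFinset v) (f := y) (by simp [hy])
    exact ⟨w, hyw, v, self_mem_Re v, by simpa using hw⟩
  · rintro w ⟨hyw, a, ha, haw⟩
    obtain ⟨g, hg, -⟩ := hM.1 (mem_verts_of_adj_of_mem_Re hb hM hv ha haw)
    have hgv : g ≠ v := fun h => hv (h ▸ hg.snd_mem)
    obtain ⟨w', hw', hneg⟩ := exists_mul_neg_of_sum_eq_zero
      (show ∑ i ∈ G.neighborFinset g, y i = 0 by simp [hy, hgv])
      (by simpa using hg.adj_sub.symm) hyw
    rw [SimpleGraph.mem_neighborFinset] at hw'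
    exact ⟨g, w', hg, hw', ⟨fun h => by simp [h] at hneg, g,
      mem_Re_of_adj_of_adj hb hM.1 ha haw hg, hw'⟩, hneg⟩

end Support

/-- the even-reachable set of the `M`-unsaturated vertices is the support,
and the odd-reachable set is the core. -/
theorem stmt9 (G : SimpleGraph V) (hb : IsBipartite G) (hc : C4kFree G)
    (M : G.Subgraph) (hM : IsMaximumMatching G M) :
    {w : V | ∃ u : V, u ∉ M.verts ∧ w ∈ Re G M u} = supp G ∧
      {w : V | ∃ u : V, u ∉ M.verts ∧ w ∈ Ro G M u} = core G := by
  have hsupp : {w : V | ∃ u : V, u ∉ M.verts ∧ w ∈ Re G M u} = supp G := by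
    ext w
    constructor
    · rintro ⟨u, hu, hw⟩
      obtain ⟨M', hM', hwM', -⟩ := exists_isMaximumMatching_of_mem_Re hM hu hw
      exact mem_supp_of_notMem_verts hb hc hM' hwM'
    · exact exists_mem_Re_of_mem_supp hb hc hM.1
  refine ⟨hsupp, ?_⟩
  unfold core
  rw [← hsupp]
  ext w
  constructor
  · rintro ⟨u, hu, hw⟩
    obtain ⟨a, ha, hwa⟩ := exists_mem_Re_of_mem_Ro hw
    exact ⟨a, ⟨u, hu, ha⟩, hwa⟩
  · rintro ⟨a, ⟨u, hu, ha⟩, hwa⟩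
    exact ⟨u, hu, mem_Ro_of_adj hb hM.1 hu ha hwa.symm⟩

end C4kPaper
end

section
/- Let G be a C_{4k}-free bipartite graph and let C_S(G) be the subgraph induced by Supp(G) ∪ Core(G) and C_N(G) the subgraph induced by Npart(G). Then Supp(C_S(G)) = Supp(G), Core(C_S(G)) = Core(G), Npart(C_N(G)) = Npart(G), and moreover Npart(C_S(G)) = Supp(C_N(G)) = Core(C_N(G)) = ∅. -/
open scoped Classical

namespace C4kPaper

open SimpleGraph

variable {V : Type*} [Fintype V] [DecidableEq V]

section

variable {α : Type*}

theorem IsBipartite.of_hom {β : Type*} {G : SimpleGraph α} {H : SimpleGraph β} (f : H →g G)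
    (hb : IsBipartite G) : IsBipartite H := by
  obtain ⟨s, hs⟩ := hb
  exact ⟨f ⁻¹' s, fun u v huv => hs (f.map_adj huv)⟩

theorem C4kFree.of_hom {β : Type*} {G : SimpleGraph α} {H : SimpleGraph β}
    (f : H →g G) (hf : Function.Injective f) (hc : C4kFree G) :
    C4kFree H := by
  intro v c hcyc hdvd
  exact hc _ (c.map f) (hcyc.map hf) (by simpa using hdvd)

/-- The Fredholm alternative for real matrices. -/
theorem exists_mulVec_eq_of_forall_vecMul {m n : Type*} [Fintype m] [Fintype n]
    (A : Matrix m n ℝ) (b : m → ℝ)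
    (h : ∀ t : m → ℝ, Matrix.vecMul t A = 0 → t ⬝ᵥ b = 0) : ∃ w, A.mulVec w = b := by
  by_contra hb
  obtain ⟨f, hfb, hf⟩ := Submodule.exists_dual_map_eq_bot_of_notMem
    (p := LinearMap.range A.mulVecLin) (x := b) (by simpa using hb) inferInstance
  have hdot : ∀ y, (fun i => f (Pi.single i 1)) ⬝ᵥ y = f y := by
    intro y
    rw [LinearMap.pi_apply_eq_sum_univ f y]
    refine Finset.sum_congr rfl fun i _ => ?_
    rw [smul_eq_mul, mul_comm]
    congr 1
    exact congrArg f (funext fun j => by simp [Pi.single_apply, eq_comm])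
  refine hfb ((hdot b).symm.trans (h _ ?_))
  refine dotProduct_eq_zero _ fun y => ?_
  rw [← Matrix.dotProduct_mulVec, hdot]
  have : f (A.mulVecLin y) ∈ (LinearMap.range A.mulVecLin).map f := ⟨_, ⟨y, rfl⟩, rfl⟩
  simpa [hf] using this

variable [Fintype α]

/-- A graph containing a closed system of vertices along which a `ZMod 4`-valued phase can always
be increased by one contains a cycle of length divisible by four. -/
theorem not_c4kFree_of_phase {G : SimpleGraph α} {T : Set α} (hT : T.Nonempty) (φ : α → ZMod 4)
    (h : ∀ a ∈ T, ∃ b ∈ T, G.Adj a b ∧ φ b = φ a + 1) : ¬ C4kFree G := by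
  intro hc
  choose! g hgT hgadj hgφ using h
  obtain ⟨t, ht⟩ := hT
  have hiter : ∀ i a, a ∈ T → g^[i] a ∈ T := by
    intro i
    induction i with
    | zero => exact fun a ha => ha
    | succ i ih => exact fun a ha => ih _ (hgT a ha)
  have hφ : ∀ i a, a ∈ T → φ (g^[i] a) = φ a + i := by
    intro i
    induction i with
    | zero => simp
    | succ i ih =>
      intro a ha
      rw [Function.iterate_succ_apply, ih _ (hgT a ha), hgφ a ha]
      push_cast
      ring
  obtain ⟨p, hp, hper⟩ : ∃ p ∈ T, 0 < Function.minimalPeriod g p := by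
    obtain ⟨i, j, hij, he⟩ := Finite.exists_ne_map_eq_of_infinite (fun i : ℕ => g^[i] t)
    wlog hlt : i < j generalizing i j
    · exact this j i hij.symm he.symm (by omega)
    refine ⟨g^[i] t, hiter i t ht, Function.IsPeriodicPt.minimalPeriod_pos (n := j - i)
      (by omega) ?_⟩
    change g^[j - i] (g^[i] t) = g^[i] t
    rw [← Function.iterate_add_apply, Nat.sub_add_cancel hlt.le]
    exact he.symm
  have walk : ∀ (i : ℕ) (a c : α), a ∈ T → g^[i] a = c → ∃ w : G.Walk a c, w.length = i ∧
      w.support = (List.range (i + 1)).map (fun k => g^[k] a) ∧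
      ∀ e ∈ w.edges, ∃ k < i, e = s(g^[k] a, g^[k + 1] a) := by
    intro i
    induction i with
    | zero =>
      rintro a _ - rfl
      exact ⟨.nil, rfl, by simp, by simp⟩
    | succ i ih =>
      intro a c ha hac
      obtain ⟨w, hl, hs, he⟩ := ih (g a) c (hgT a ha) hac
      refine ⟨.cons (hgadj a ha) w, by simp [hl], ?_, ?_⟩
      · rw [Walk.support_cons, hs, List.range_succ_eq_map (n := i + 1),
          List.map_cons, List.map_map]
        rfl
      · intro e hmem
        rw [Walk.edges_cons, List.mem_cons] at hmem
        rcases hmem with rfl | hmem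
        · exact ⟨0, by omega, rfl⟩
        · obtain ⟨k, hk, rfl⟩ := he e hmem
          exact ⟨k + 1, by omega, rfl⟩
  obtain ⟨n, hn⟩ : ∃ n, Function.minimalPeriod g p = n + 1 := ⟨_, (Nat.sub_add_cancel hper).symm⟩
  have hclose : g^[n] (g p) = p := by
    have := Function.iterate_minimalPeriod (f := g) (x := p)
    rwa [hn] at this
  have hinj : ∀ i j, i < n + 1 → j < n + 1 → g^[i] p = g^[j] p → i = j := by
    intro i j hi hj he
    rw [← hn] at hi hj
    exact Function.iterate_injOn_Iio_minimalPeriod hi hj he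
  obtain ⟨w, hl, hs, he⟩ := walk n (g p) p (hgT p hp) hclose
  have hpath : w.IsPath := by
    rw [Walk.isPath_def, hs]
    refine List.Nodup.map_on ?_ List.nodup_range
    intro i hi j hj hij
    rw [List.mem_range] at hi hj
    simp only [← Function.iterate_succ_apply] at hij
    rcases Nat.lt_or_ge i n with hin | hin <;> rcases Nat.lt_or_ge j n with hjn | hjn
    · exact Nat.succ_injective (hinj _ _ (by omega) (by omega) hij)
    · obtain rfl : j = n := by omega
      rw [Function.iterate_succ_apply g j, hclose] at hij
      exact absurd (hinj (i + 1) 0 (by omega) (by omega) hij) (by omega)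
    · obtain rfl : i = n := by omega
      rw [Function.iterate_succ_apply g i, hclose] at hij
      exact absurd (hinj 0 (j + 1) (by omega) (by omega) hij) (by omega)
    · omega
  have hcycle : (Walk.cons (hgadj p hp) w).IsCycle := by
    rw [Walk.cons_isCycle_iff]
    refine ⟨hpath, fun hmem => ?_⟩
    obtain ⟨k, hk, hke⟩ := he _ hmem
    rw [← Function.iterate_succ_apply, ← Function.iterate_succ_apply, Sym2.eq_iff] at hke
    rcases hke with ⟨h1, -⟩ | ⟨h1, h2⟩
    · exact absurd (hinj 0 (k + 1) (by omega) (by omega) h1) (by omega)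
    · obtain rfl : k = 0 := by simpa using (hinj 1 (k + 1) (by omega) (by omega) h2).symm
      have h2 := hφ 2 p hp
      rw [← h1, left_eq_add] at h2
      exact absurd h2 (by decide)
  refine hc _ _ hcycle ?_
  have := hφ (n + 1) p hp
  rw [Function.iterate_succ_apply, hclose, left_eq_add, ZMod.natCast_eq_zero_iff] at this
  simpa [hl] using this

theorem mem_nullSet {G : SimpleGraph α} [DecidableRel G.Adj] {x : α → ℝ} :
    x ∈ nullSet G ↔ ∀ v, ∑ u, (if G.Adj v u then x u else 0) = 0 := by
  simp only [nullSet, Set.mem_ofPred_eq, funext_iff, Matrix.mulVec, dotProduct, adjMatrix_apply,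
    ite_mul, one_mul, zero_mul, Pi.zero_apply]

theorem mulVec_adjMatrix_eq_zero_iff {G : SimpleGraph α} [DecidableRel G.Adj] {x : α → ℝ} :
    (G.adjMatrix ℝ).mulVec x = 0 ↔ x ∈ nullSet G := by
  simp [mem_nullSet, funext_iff, Matrix.mulVec, dotProduct, adjMatrix_apply]

theorem exists_adj_pos {G : SimpleGraph α} {x : α → ℝ} (hx : x ∈ nullSet G) {a b : α}
    (hab : G.Adj a b) (hb : x b ≠ 0) : ∃ c, G.Adj a c ∧ 0 < x c := by
  obtain ⟨c, -, hc⟩ := Finset.exists_pos_of_sum_zero_of_exists_nonzero _ (mem_nullSet.1 hx a)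
    ⟨b, Finset.mem_univ b, by simpa [hab] using hb⟩
  split_ifs at hc with h
  · exact ⟨c, h, hc⟩
  · exact absurd hc (lt_irrefl 0)

theorem neg_mem_nullSet {G : SimpleGraph α} {x : α → ℝ} (hx : x ∈ nullSet G) :
    -x ∈ nullSet G := by
  change Matrix.mulVec _ _ = 0
  rw [Matrix.mulVec_neg, show Matrix.mulVec _ _ = 0 from hx, neg_zero]

/-- The signs of a null vector along a path it does not vanish on force a cycle of length divisible
by four. -/
theorem eq_zero_or_eq_zero_of_adj {G : SimpleGraph α} (hb : IsBipartite G) (hc : C4kFree G)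
    {x : α → ℝ} (hx : x ∈ nullSet G) {u v : α} (huv : G.Adj u v) : x u = 0 ∨ x v = 0 := by
  by_contra! hne
  obtain ⟨s, hs⟩ := hb
  let φ : α → ZMod 4 := fun a =>
    if a ∈ s then (if 0 < x a then 0 else 2) else (if 0 < x a then 1 else 3)
  refine not_c4kFree_of_phase (T := {a | x a ≠ 0 ∧ ∃ b, G.Adj a b ∧ x b ≠ 0})
    ⟨u, hne.1, v, huv, hne.2⟩ φ ?_ hc
  rintro a ⟨ha, b, hab, hxb⟩
  obtain ⟨c, hac, hcpos⟩ := exists_adj_pos hx hab hxb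
  obtain ⟨d, had, hdneg⟩ := exists_adj_pos (neg_mem_nullSet hx) hab (by simpa using hxb)
  have hdneg : x d < 0 := by simpa using hdneg
  have hd0 : ¬ 0 < x d := hdneg.not_gt
  have hsc := hs hac
  have hsd := hs had
  by_cases has : a ∈ s
  · have h1 : c ∉ s := hsc.1 has
    have h2 : d ∉ s := hsd.1 has
    by_cases hpos : 0 < x a
    · exact ⟨c, ⟨hcpos.ne', a, hac.symm, ha⟩, hac, by simp [φ, has, h1, hpos, hcpos]⟩
    · exact ⟨d, ⟨hdneg.ne, a, had.symm, ha⟩, had, by simp [φ, has, h2, hpos, hd0]; decide⟩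
  · have h1 : c ∈ s := by tauto
    have h2 : d ∈ s := by tauto
    by_cases hpos : 0 < x a
    · exact ⟨d, ⟨hdneg.ne, a, had.symm, ha⟩, had, by simp [φ, has, h2, hpos, hd0]; decide⟩
    · exact ⟨c, ⟨hcpos.ne', a, hac.symm, ha⟩, hac, by simp [φ, has, h1, hpos, hcpos]; decide⟩

/-- The support of a `C_{4k}`-free bipartite graph is independent. -/
theorem not_adj_of_mem_supp {G : SimpleGraph α} (hb : IsBipartite G) (hc : C4kFree G)
    {u v : α} (hu : u ∈ supp G) (hv : v ∈ supp G) : ¬ G.Adj u v := by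
  intro huv
  obtain ⟨x, hx, hxu⟩ := hu
  obtain ⟨y, hy, hyv⟩ := hv
  obtain ⟨s, hs⟩ := id hb
  have hw : (fun a => if a ∈ s ↔ u ∈ s then x a else y a) ∈ nullSet G := by
    rw [mem_nullSet] at hx hy ⊢
    intro a
    by_cases ha : a ∈ s ↔ u ∈ s
    · refine (Finset.sum_congr rfl fun b _ => ?_).trans (hy a)
      by_cases hab : G.Adj a b
      · have := hs hab
        rw [if_neg (by tauto : ¬ (b ∈ s ↔ u ∈ s))]
      · simp [hab]
    · refine (Finset.sum_congr rfl fun b _ => ?_).trans (hx a)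
      by_cases hab : G.Adj a b
      · have := hs hab
        rw [if_pos (by tauto : b ∈ s ↔ u ∈ s)]
      · simp [hab]
  have huv' := hs huv
  rcases eq_zero_or_eq_zero_of_adj hb hc hw huv with h | h
  · exact hxu (by simpa using h)
  · rw [if_neg (by tauto)] at h
    exact hyv h

theorem sum_induce (G : SimpleGraph α) {t : Set α} [Fintype t]
    {x : α → ℝ} (hx : ∀ v ∉ t, x v = 0) (v : t) :
    ∑ u : t, (if (G.induce t).Adj v u then x u else 0) = ∑ u, if G.Adj v u then x u else 0 := by
  refine Fintype.sum_of_injective Subtype.val Subtype.val_injective _ _ (fun u hu => ?_)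
    fun u => by simp
  simp [hx u (by simpa using hu)]

/-- A null vector of `G` stays null after restriction to vertices containing its support. -/
theorem restrict_mem_nullSet {G : SimpleGraph α} {t : Set α} [Fintype t] {x : α → ℝ}
    (hx : x ∈ nullSet G) (ht : ∀ v ∉ t, x v = 0) : (fun v : t => x v) ∈ nullSet (G.induce t) :=
  mem_nullSet.2 fun v => (sum_induce G ht v).trans (mem_nullSet.1 hx v)

theorem eq_zero_of_notMem_supp {G : SimpleGraph α} {x : α → ℝ} (hx : x ∈ nullSet G) {v : α}
    (hv : v ∉ supp G) : x v = 0 := by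
  by_contra h
  exact hv ⟨x, hx, h⟩

theorem mem_supp_induce_iff {G : SimpleGraph α} [Fintype ↥(supp G ∪ core G)]
    (hb : IsBipartite G) (hc : C4kFree G) (v : ↥(supp G ∪ core G)) :
    v ∈ supp (G.induce (supp G ∪ core G)) ↔ (v : α) ∈ supp G := by
  have hsub : ∀ v : ↥(supp G ∪ core G), (v : α) ∈ supp G →
      v ∈ supp (G.induce (supp G ∪ core G)) := by
    rintro v ⟨x, hx, hxv⟩
    exact ⟨_, restrict_mem_nullSet hx
      fun w hw => eq_zero_of_notMem_supp hx fun h => hw (Or.inl h), hxv⟩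
  refine ⟨fun hv => ?_, hsub v⟩
  rcases v.2 with h | ⟨w, hw, hvw⟩
  · exact h
  · let f := (Embedding.induce (G := G) (supp G ∪ core G)).toHom
    exact absurd (show (G.induce _).Adj v ⟨w, Or.inl hw⟩ from hvw)
      (not_adj_of_mem_supp (hb.of_hom f) (hc.of_hom f Subtype.val_injective) hv (hsub _ hw))

theorem mem_core_induce_iff {G : SimpleGraph α} [Fintype ↥(supp G ∪ core G)]
    (hb : IsBipartite G) (hc : C4kFree G) (v : ↥(supp G ∪ core G)) :
    v ∈ core (G.induce (supp G ∪ core G)) ↔ (v : α) ∈ core G := by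
  constructor
  · rintro ⟨w, hw, hvw⟩
    exact ⟨w, (mem_supp_induce_iff hb hc w).1 hw, hvw⟩
  · rintro ⟨w, hw, hvw⟩
    exact ⟨⟨w, Or.inl hw⟩, (mem_supp_induce_iff hb hc _).2 hw, hvw⟩

theorem supp_subset_supp_between (G : SimpleGraph α) :
    supp G ⊆ supp (G.between (supp G) (core G)) := by
  rintro v ⟨x, hx, hxv⟩
  refine ⟨x, mem_nullSet.2 fun a => ?_, hxv⟩
  by_cases ha : a ∈ core G
  · refine (Finset.sum_congr rfl fun b _ => ?_).trans (mem_nullSet.1 hx a)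
    by_cases hbs : b ∈ supp G
    · simp [between_adj, ha, hbs]
    · simp [eq_zero_of_notMem_supp hx hbs]
  · refine Finset.sum_eq_zero fun b _ => ?_
    by_cases hbs : b ∈ supp G
    · have : ¬ G.Adj a b := fun h => ha ⟨b, hbs, h⟩
      simp [between_adj, this]
    · simp [eq_zero_of_notMem_supp hx hbs]

/-- Any prescribed values on the core are attained by applying the adjacency matrix to a vector
carried by the support. -/
theorem exists_sum_eq_on_core {G : SimpleGraph α} (hb : IsBipartite G) (hc : C4kFree G)
    (y : α → ℝ) : ∃ w : α → ℝ, (∀ v ∉ supp G, w v = 0) ∧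
      ∀ c ∈ core G, ∑ u, (if G.Adj c u then w u else 0) = y c := by
  set H := G.between (supp G) (core G)
  have hdisj : ∀ c ∈ core G, c ∉ supp G := fun c ⟨w, hw, hcw⟩ h =>
    not_adj_of_mem_supp hb hc h hw hcw
  let f : H →g G := Hom.ofLE between_le
  have hperp : ∀ t, Matrix.vecMul t (H.adjMatrix ℝ) = 0 →
      t ⬝ᵥ (fun v => if v ∈ core G then y v else 0) = 0 := by
    intro t ht
    rw [← Matrix.mulVec_transpose, transpose_adjMatrix] at ht
    refine Finset.sum_eq_zero fun c _ => ?_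
    by_cases hcc : c ∈ core G
    · obtain ⟨s, hs, hcs⟩ := id hcc
      have htc : t c = 0 := by
        refine eq_zero_of_notMem_supp (G := H) (mulVec_adjMatrix_eq_zero_iff.1 ht) fun h => ?_
        exact not_adj_of_mem_supp (hb.of_hom f) (hc.of_hom f Function.injective_id) h
          (supp_subset_supp_between G hs) ⟨hcs, Or.inr ⟨hcc, hs⟩⟩
      simp [htc]
    · simp [hcc]
  obtain ⟨w, hw⟩ := exists_mulVec_eq_of_forall_vecMul _ _ hperp
  refine ⟨fun v => if v ∈ supp G then w v else 0, fun v hv => if_neg hv, fun c hcc => ?_⟩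
  have hwc := congrFun hw c
  rw [if_pos hcc] at hwc
  rw [← hwc]
  refine Finset.sum_congr rfl fun u _ => ?_
  by_cases hu : u ∈ supp G <;> simp [H, adjMatrix_apply, between_adj, hcc, hdisj c hcc, hu]

theorem supp_induce_npart {G : SimpleGraph α} [Fintype ↥(npart G)] (hb : IsBipartite G)
    (hc : C4kFree G) : supp (G.induce (npart G)) = ∅ := by
  rw [Set.eq_empty_iff_forall_notMem]
  rintro v ⟨z, hz, hzv⟩
  let x : α → ℝ := fun v => if h : v ∈ npart G then z ⟨v, h⟩ else 0
  have hx0 : ∀ v ∉ npart G, x v = 0 := fun v hv => dif_neg hv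
  have hxz : ∀ v : npart G, x v = z v := fun v => dif_pos v.2
  obtain ⟨w, hw0, hw⟩ :=
    exists_sum_eq_on_core hb hc fun c => -∑ u, (if G.Adj c u then x u else 0)
  have hwx : w + x ∈ nullSet G := by
    rw [mem_nullSet]
    intro a
    have hsplit : ∑ u, (if G.Adj a u then (w + x) u else 0) =
        ∑ u, (if G.Adj a u then w u else 0) + ∑ u, (if G.Adj a u then x u else 0) := by
      rw [← Finset.sum_add_distrib]
      exact Finset.sum_congr rfl fun u _ => by split_ifs <;> simp
    rw [hsplit]
    by_cases hac : a ∈ core G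
    · rw [hw a hac, neg_add_cancel]
    have hwa : ∑ u, (if G.Adj a u then w u else 0) = 0 := by
      refine Finset.sum_eq_zero fun u _ => ?_
      by_cases hu : u ∈ supp G
      · exact if_neg fun h => hac ⟨u, hu, h⟩
      · simp [hw0 u hu]
    rw [hwa, zero_add]
    by_cases has : a ∈ supp G
    · refine Finset.sum_eq_zero fun u _ => ?_
      by_cases hu : u ∈ npart G
      · exact if_neg fun h => hu (Or.inr ⟨a, has, h.symm⟩)
      · simp [hx0 u hu]
    · have han : a ∈ npart G := fun h => h.elim has hac
      rw [← sum_induce G hx0 ⟨a, han⟩]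
      simpa only [hxz] using mem_nullSet.1 hz ⟨a, han⟩
  have hvs : (v : α) ∉ supp G := fun h => v.2 (Or.inl h)
  have := eq_zero_of_notMem_supp hwx hvs
  rw [Pi.add_apply, hw0 _ hvs, zero_add, hxz] at this
  exact hzv this

end

/-- null decomposition of a `C_{4k}`-free bipartite graph. -/
theorem stmt12 (G : SimpleGraph V) (hb : IsBipartite G) (hc : C4kFree G) :
    Subtype.val '' supp (G.induce (supp G ∪ core G)) = supp G ∧
    Subtype.val '' core (G.induce (supp G ∪ core G)) = core G ∧
    Subtype.val '' npart (G.induce (npart G)) = npart G ∧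
    npart (G.induce (supp G ∪ core G)) = ∅ ∧
    supp (G.induce (npart G)) = ∅ ∧
    core (G.induce (npart G)) = ∅ := by
  have hS := mem_supp_induce_iff hb hc
  have hC := mem_core_induce_iff hb hc
  have hN := supp_induce_npart hb hc
  have hNc : core (G.induce (npart G)) = ∅ := by simp [core, hN]
  refine ⟨?_, ?_, ?_, ?_, hN, hNc⟩
  · ext v
    constructor
    · rintro ⟨w, hw, rfl⟩
      exact (hS w).1 hw
    · exact fun hv => ⟨⟨v, Or.inl hv⟩, (hS _).2 hv, rfl⟩
  · ext v
    constructor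
    · rintro ⟨w, hw, rfl⟩
      exact (hC w).1 hw
    · exact fun hv => ⟨⟨v, Or.inr hv⟩, (hC _).2 hv, rfl⟩
  · have : npart (G.induce (npart G)) = Set.univ := by
      rw [npart.eq_def (G.induce _), hN, hNc, Set.union_empty, Set.compl_empty]
    rw [this, Set.image_univ, Subtype.range_coe]
  · rw [Set.eq_empty_iff_forall_notMem]
    exact fun v hv => hv (v.2.imp (hS v).2 (hC v).2)

end C4kPaper
end

section
/- Let G be a C_{4k}-free bipartite graph, M a maximum matching, and v ∈ Npart(G) with M(v) its matched partner. Then ν(G − v − M(v)) = ν(G) − 1, the nullity of G − v − M(v) equals the nullity of G, and rank(G − v − M(v)) = rank(G) − 2. -/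
open scoped Classical

namespace C4kPaper

open SimpleGraph

variable {V : Type*} [Fintype V] [DecidableEq V]

set_option linter.unusedSectionVars false

/-- A function on `ℕ` that is injective on `{0, …, m}` and has consecutive values adjacent traces
out a path, here listed backwards. -/
theorem exists_isPath_of_injOn {G : SimpleGraph V} {f : ℕ → V} (m : ℕ)
    (hadj : ∀ i < m, G.Adj (f i) (f (i + 1))) (hinj : Set.InjOn f (Set.Iic m)) :
    ∃ p : G.Walk (f m) (f 0), p.IsPath ∧ p.length = m ∧
      (∀ a ∈ p.support, ∃ i ≤ m, a = f i) ∧ ∀ e ∈ p.edges, ∃ i < m, e = s(f i, f (i + 1)) := by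
  induction m with
  | zero => exact ⟨Walk.nil, by simp⟩
  | succ m ih =>
    obtain ⟨p, hp, hl, hs, he⟩ := ih (fun i hi => hadj i (by omega))
      (hinj.mono (Set.Iic_subset_Iic.2 (by omega)))
    refine ⟨Walk.cons (hadj m (by omega)).symm p, ?_, by simp [hl], ?_, ?_⟩
    · rw [Walk.cons_isPath_iff]
      refine ⟨hp, fun h => ?_⟩
      obtain ⟨i, hi, hfi⟩ := hs _ h
      have := hinj (Set.mem_Iic.2 le_rfl) (Set.mem_Iic.2 (by omega)) hfi
      omega
    · intro a ha
      rw [Walk.support_cons, List.mem_cons] at ha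
      obtain rfl | ha := ha
      · exact ⟨m + 1, le_rfl, rfl⟩
      · obtain ⟨i, hi, h⟩ := hs a ha
        exact ⟨i, by omega, h⟩
    · intro e h
      rw [Walk.edges_cons, List.mem_cons] at h
      obtain rfl | h := h
      · exact ⟨m, by omega, Sym2.eq_swap⟩
      · obtain ⟨i, hi, h⟩ := he e h
        exact ⟨i, by omega, h⟩

theorem exists_isCycle_of_injOn {G : SimpleGraph V} {f : ℕ → V} {n : ℕ} (hn : 3 ≤ n)
    (hadj : ∀ i < n, G.Adj (f i) (f (i + 1))) (hinj : Set.InjOn f (Set.Iio n)) (h0 : f n = f 0) :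
    ∃ (v : V) (c : G.Walk v v), c.IsCycle ∧ c.length = n := by
  obtain ⟨m, rfl⟩ : ∃ m, n = m + 1 := ⟨n - 1, by omega⟩
  obtain ⟨p, hp, hl, -, he⟩ := exists_isPath_of_injOn m (fun i hi => hadj i (by omega))
    (hinj.mono fun i hi => by simp only [Set.mem_Iic, Set.mem_Iio] at *; omega)
  have h := hadj m (by omega)
  rw [h0] at h
  refine ⟨f 0, Walk.cons h.symm p, (Walk.cons_isCycle_iff p h.symm).2 ⟨hp, fun hmem => ?_⟩,
    by simp [hl]⟩
  obtain ⟨i, hi, hs⟩ := he _ hmem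
  rw [Sym2.eq_iff] at hs
  have key : ∀ {j k : ℕ}, j ≤ m → k ≤ m → f j = f k → j = k := fun hj hk h =>
    hinj (Set.mem_Iio.2 (by omega)) (Set.mem_Iio.2 (by omega)) h
  obtain ⟨h1, h2⟩ | ⟨h1, h2⟩ := hs
  · have := key (by omega) (by omega) h1
    have := key (by omega) (by omega) h2
    omega
  · have := key (by omega) (by omega) h1
    have := key (by omega) (by omega) h2
    omega

/-- In a `C4kFree` bipartite graph, a vector that is supported on the vertices of a matching and
lies in the null space vanishes. -/
theorem eq_zero_of_supported_on_matching {G : SimpleGraph V} (hb : IsBipartite G)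
    (hc : C4kFree G) {M : G.Subgraph} (hM : M.IsMatching) {x : V → ℝ}
    (hx : ∀ a, a ∉ M.verts → x a = 0) (hA : ∀ b, ∑ a, (if G.Adj a b then x a else 0) = 0) :
    x = 0 := by
  by_contra hne
  obtain ⟨a₀, ha₀⟩ := Function.ne_iff.1 hne
  obtain ⟨s, hs⟩ := hb
  have step : ∀ a : {a // x a ≠ 0}, ∃ (b : V) (c : {a // x a ≠ 0}),
      M.Adj a b ∧ G.Adj b c ∧ x a * x c < 0 := by
    rintro ⟨a, ha⟩
    obtain ⟨b, hab, -⟩ := hM (by_contra fun h => ha (hx a h) : a ∈ M.verts)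
    by_contra! hcon
    have h := hA b
    have hpos : 0 < ∑ c, x a * (if G.Adj c b then x c else 0) := by
      refine Finset.sum_pos' (fun c _ => ?_) ⟨a, Finset.mem_univ a, ?_⟩
      · split_ifs with hcb
        · by_cases hxc : x c = 0
          · simp [hxc]
          · exact hcon b ⟨c, hxc⟩ hab hcb.symm
        · simp
      · rw [if_pos hab.adj_sub]
        exact mul_self_pos.2 ha
    rw [← Finset.mul_sum, h, mul_zero] at hpos
    exact lt_irrefl _ hpos
  choose m g hm hg hlt using step
  obtain ⟨i, j, hij, hgij⟩ : ∃ i j : ℕ, i < j ∧ g^[i] ⟨a₀, ha₀⟩ = g^[j] ⟨a₀, ha₀⟩ := by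
    obtain ⟨i, j, hne, h⟩ :=
      Finite.exists_ne_map_eq_of_infinite fun i : ℕ => g^[i] ⟨a₀, ha₀⟩
    rcases lt_or_gt_of_ne hne with hl | hl
    exacts [⟨i, j, hl, h⟩, ⟨j, i, hl, h.symm⟩]
  set y := g^[i] ⟨a₀, ha₀⟩ with hy
  have hper : Function.IsPeriodicPt g (j - i) y := by
    change g^[j - i] y = y
    rw [hy, ← Function.iterate_add_apply, Nat.sub_add_cancel hij.le]
    exact hgij.symm
  set p := Function.minimalPeriod g y with hp
  have hp0 : 0 < p := hper.minimalPeriod_pos (by omega)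
  have hpy : g^[p] y = y := Function.isPeriodicPt_minimalPeriod g y
  have hinj : Set.InjOn (fun k => g^[k] y) (Set.Iio p) := Function.iterate_injOn_Iio_minimalPeriod
  have hsign : ∀ k, 0 < (-1 : ℝ) ^ k * (x y * x (g^[k] y)) := by
    intro k
    induction k with
    | zero => simpa using y.2
    | succ k ih =>
      rw [Function.iterate_succ_apply']
      have h1 := hlt (g^[k] y)
      have h2 := mul_pos_of_neg_of_neg h1
        (by linarith : -((-1 : ℝ) ^ k * (x y * x (g^[k] y))) < 0)
      have h3 : 0 < x (g^[k] y) * x (g^[k] y) := mul_self_pos.2 (g^[k] y).2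
      refine pos_of_mul_pos_left (b := x (g^[k] y) * x (g^[k] y)) ?_ h3.le
      rw [pow_succ]
      linarith
  have hpe : Even p := by
    by_contra hodd
    have h := hsign p
    rw [hpy, (Nat.not_even_iff_odd.1 hodd).neg_one_pow] at h
    nlinarith [mul_self_nonneg (x y)]
  have hside : ∀ k, ((g^[k] y : V) ∈ s ↔ (y : V) ∈ s) := by
    intro k
    induction k with
    | zero => rfl
    | succ k ih =>
      rw [Function.iterate_succ_apply', ← ih]
      have h1 := hs (hm (g^[k] y)).adj_sub
      have h2 := hs (hg (g^[k] y))
      tauto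
  have hsidem : ∀ k, (m (g^[k] y) ∈ s ↔ (y : V) ∉ s) := by
    intro k
    have h1 := hs (hm (g^[k] y)).adj_sub
    have h2 := hside k
    tauto
  let f : ℕ → V := fun k => if Even k then (g^[k / 2] y : V) else m (g^[k / 2] y)
  have hfe : ∀ k, f (2 * k) = g^[k] y := fun k => by simp [f]
  have hfo : ∀ k, f (2 * k + 1) = m (g^[k] y) := fun k => by
    have : (2 * k + 1) / 2 = k := by omega
    simp [f, this]
  obtain ⟨v, c, hcyc, hlen⟩ := exists_isCycle_of_injOn (G := G) (f := f) (n := 2 * p)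
    (by obtain ⟨q, hq⟩ := hpe; omega) (fun k _ => by
      obtain ⟨q, rfl | rfl⟩ := Nat.even_or_odd' k
      · rw [hfe, hfo]
        exact (hm _).adj_sub
      · rw [hfo, show 2 * q + 1 + 1 = 2 * (q + 1) by ring, hfe, Function.iterate_succ_apply']
        exact hg _) (fun k hk l hl hkl => by
      simp only [Set.mem_Iio] at hk hl
      obtain ⟨q, rfl | rfl⟩ := Nat.even_or_odd' k <;> obtain ⟨r, rfl | rfl⟩ := Nat.even_or_odd' l
      · rw [hfe, hfe] at hkl
        rw [hinj (Set.mem_Iio.2 (by omega : q < p)) (Set.mem_Iio.2 (by omega : r < p))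
          (Subtype.ext hkl)]
      · rw [hfe, hfo] at hkl
        have h1 := hside q
        have h2 := hsidem r
        rw [hkl] at h1
        tauto
      · rw [hfe, hfo] at hkl
        have h1 := hside r
        have h2 := hsidem q
        rw [hkl] at h2
        tauto
      · rw [hfo, hfo] at hkl
        have h := hm (g^[q] y)
        rw [hkl] at h
        rw [hinj (Set.mem_Iio.2 (by omega : q < p)) (Set.mem_Iio.2 (by omega : r < p))
          (Subtype.ext (hM.eq_of_adj_right h (hm (g^[r] y))))])
    (by rw [hfe, hpy]; exact (hfe 0).symm)
  refine hc v c hcyc ?_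
  obtain ⟨q, hq⟩ := hpe
  exact ⟨q, by omega⟩

/-- A matching of a bipartite graph has as many edges as vertices on either side. -/
theorem ncard_verts_inter_eq_ncard_edgeSet {G : SimpleGraph V} {s : Set V}
    (hs : ∀ ⦃u v : V⦄, G.Adj u v → (u ∈ s ↔ v ∉ s)) {M : G.Subgraph} (hM : M.IsMatching) :
    (M.verts ∩ s).ncard = M.edgeSet.ncard := by
  refine Set.ncard_congr (fun a ha => (hM.toEdge ⟨a, ha.1⟩ : Sym2 V))
    (fun a ha => Subtype.coe_prop _) ?_ ?_
  · intro a b ha hb h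
    obtain ⟨a', haa', -⟩ := hM ha.1
    obtain ⟨b', hbb', -⟩ := hM hb.1
    simp only [hM.toEdge_eq_of_adj haa', hM.toEdge_eq_of_adj hbb'] at h
    rw [Sym2.eq_iff] at h
    obtain ⟨h, -⟩ | ⟨rfl, rfl⟩ := h
    · exact h
    · exact absurd hb.2 ((hs haa'.adj_sub).1 ha.2)
  · intro e
    induction e with | _ a b
    intro hab
    have hab : M.Adj a b := hab
    by_cases ha : a ∈ s
    · exact ⟨a, ⟨hab.fst_mem, ha⟩, by simp [hM.toEdge_eq_of_adj hab]⟩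
    · refine ⟨b, ⟨hab.snd_mem, by_contra fun h => ha ((hs hab.adj_sub).2 h)⟩, ?_⟩
      simp [hM.toEdge_eq_of_adj hab.symm, Sym2.eq_swap]

theorem bddAbove_matching (G : SimpleGraph V) :
    BddAbove {n | ∃ M : G.Subgraph, M.IsMatching ∧ M.edgeSet.ncard = n} := by
  refine ⟨(Set.univ : Set (Sym2 V)).ncard, ?_⟩
  rintro n ⟨M, -, rfl⟩
  exact Set.ncard_le_ncard (Set.subset_univ _)

theorem ncard_edgeSet_le_matchNum {G : SimpleGraph V} {M : G.Subgraph} (hM : M.IsMatching) :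
    M.edgeSet.ncard ≤ matchNum G :=
  le_csSup (bddAbove_matching G) ⟨M, hM, rfl⟩

theorem exists_isMatching_ncard_eq_matchNum (G : SimpleGraph V) :
    ∃ M : G.Subgraph, M.IsMatching ∧ M.edgeSet.ncard = matchNum G :=
  Nat.sSup_mem (s := {n | ∃ M : G.Subgraph, M.IsMatching ∧ M.edgeSet.ncard = n})
    ⟨_, ⊥, by simp [Subgraph.IsMatching], rfl⟩ (bddAbove_matching G)

theorem two_mul_matchNum_le_rk {G : SimpleGraph V} (hb : IsBipartite G) (hc : C4kFree G) :
    2 * matchNum G ≤ rk G := by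
  obtain ⟨M, hM, hcard⟩ := exists_isMatching_ncard_eq_matchNum G
  have hli : LinearIndependent ℝ fun a : M.verts => (G.adjMatrix ℝ).row a := by
    rw [Fintype.linearIndependent_iff]
    intro g hg
    have h0 : (fun a => if h : a ∈ M.verts then g ⟨a, h⟩ else 0) = (0 : V → ℝ) := by
      refine eq_zero_of_supported_on_matching hb hc hM (fun a ha => dif_neg ha) fun b => ?_
      have h := congrFun hg b
      simp only [Finset.sum_apply, Pi.smul_apply, Matrix.row_apply, adjMatrix_apply, smul_eq_mul,
        mul_ite, mul_one, mul_zero, Pi.zero_apply] at h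
      refine Eq.trans ?_ h
      refine (Finset.sum_of_injOn Subtype.val Subtype.val_injective.injOn
        (fun _ _ => by simp) (fun a _ ha => ?_) fun a _ => ?_).symm
      · have : a ∉ M.verts := by simpa using ha
        simp [this]
      · simp
    intro a
    simpa using congrFun h0 a
  have hle : Fintype.card M.verts ≤ rk G := by
    rw [← finrank_span_eq_card hli, rk, Matrix.rank_eq_finrank_span_row]
    exact Submodule.finrank_mono (Submodule.span_mono (Set.range_comp_subset_range _ _))
  obtain ⟨s, hs⟩ := hb
  have h1 := ncard_verts_inter_eq_ncard_edgeSet hs hM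
  have h2 := ncard_verts_inter_eq_ncard_edgeSet (s := sᶜ)
    (fun u v h => by have := hs h; simp only [Set.mem_compl_iff]; tauto) hM
  have h3 := Set.ncard_inter_add_ncard_sdiff_eq_ncard M.verts s
  rw [Set.sdiff_eq, h1, h2, hcard, ← Nat.card_coe_set_eq, Nat.card_eq_fintype_card] at h3
  omega

/-- The subgraph whose edges are the pairs in a relation. -/
def subgraphOfRel {G : SimpleGraph V} (R : V → V → Prop) (hR : ∀ a b, R a b → G.Adj a b)
    (hsymm : ∀ a b, R a b → R b a) : G.Subgraph where
  verts := {a | ∃ b, R a b}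
  Adj := R
  adj_sub h := hR _ _ h
  edge_vert h := ⟨_, h⟩
  symm := ⟨hsymm⟩

theorem isMatching_subgraphOfRel {G : SimpleGraph V} {R : V → V → Prop}
    {hR : ∀ a b, R a b → G.Adj a b} {hsymm : ∀ a b, R a b → R b a}
    (huniq : ∀ a b c, R a b → R a c → b = c) : (subgraphOfRel R hR hsymm).IsMatching := by
  rintro a ⟨b, hab⟩
  exact ⟨b, hab, fun c hac => huniq a c b hac hab⟩

/-- An injective choice of neighbours on a set of vertices of one side yields a matching. -/
theorem ncard_le_matchNum {G : SimpleGraph V} {s t : Set V}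
    (hs : ∀ ⦃u v : V⦄, G.Adj u v → (u ∈ s ↔ v ∉ s)) (hts : t ⊆ s) {f : V → V}
    (hf : Set.InjOn f t) (hadj : ∀ a ∈ t, G.Adj a (f a)) : t.ncard ≤ matchNum G := by
  have hft : ∀ a ∈ t, f a ∉ s := fun a ha => (hs (hadj a ha)).1 (hts ha)
  have hM : (subgraphOfRel (G := G) (fun a b => (a ∈ t ∧ f a = b) ∨ (b ∈ t ∧ f b = a))
      (by
        rintro a b (⟨h, rfl⟩ | ⟨h, rfl⟩)
        exacts [hadj _ h, (hadj _ h).symm])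
      (fun a b h => h.symm)).IsMatching := by
    refine isMatching_subgraphOfRel ?_
    rintro a b c (⟨h, rfl⟩ | ⟨h, rfl⟩) (⟨h', h''⟩ | ⟨h', h''⟩)
    · exact h''
    · exact absurd (hts h) (h'' ▸ hft _ h')
    · exact absurd (hts h') (hft _ h)
    · exact hf h h' h''.symm
  refine le_trans ?_ (ncard_edgeSet_le_matchNum hM)
  rw [← ncard_verts_inter_eq_ncard_edgeSet hs hM]
  exact Set.ncard_le_ncard fun a ha => ⟨⟨f a, Or.inl ⟨ha, rfl⟩⟩, hts ha⟩

theorem exists_injOn_adj_of_linearIndependent {G : SimpleGraph V} {t : Set V}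
    (hli : LinearIndependent ℝ fun a : t => (G.adjMatrix ℝ).row a) :
    ∃ f : V → V, Set.InjOn f t ∧ ∀ a ∈ t, G.Adj a (f a) := by
  obtain ⟨f, hf, hadj⟩ := (Finset.all_card_le_biUnion_card_iff_exists_injective
    fun a : t => G.neighborFinset a).1 fun S => by
      let N := S.biUnion fun a : t => G.neighborFinset a
      have hS : LinearIndependent ℝ fun a : S => (G.adjMatrix ℝ).row a :=
        hli.comp (fun a : S => (a : t)) Subtype.val_injective
      have h := linearIndependent_le_span' _ hS
        ((N.image fun c => (Pi.single c 1 : V → ℝ) : Finset (V → ℝ)) : Set (V → ℝ)) (by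
          rintro _ ⟨a, rfl⟩
          have : (G.adjMatrix ℝ).row a =
              ∑ c ∈ G.neighborFinset a, (Pi.single c 1 : V → ℝ) := by
            ext b
            simp [Finset.sum_apply, Pi.single_apply, adjMatrix_apply]
          simp only [this]
          refine Submodule.sum_mem _ fun c hc => Submodule.subset_span ?_
          exact Finset.mem_coe.2 (Finset.mem_image_of_mem _
            (Finset.mem_biUnion.2 ⟨a, a.2, hc⟩)))
      simp only [Cardinal.mk_coe_finset, Nat.cast_le, Fintype.card_coe, Finset.coe_sort_coe] at h
      exact h.trans Finset.card_image_le
  refine ⟨fun a => if h : a ∈ t then f ⟨a, h⟩ else a, fun a ha b hb hab => ?_, fun a ha => ?_⟩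
  · simp only [dif_pos ha, dif_pos hb] at hab
    exact congrArg Subtype.val (hf hab)
  · simpa [dif_pos ha] using hadj ⟨a, ha⟩

theorem rk_le_two_mul_matchNum {G : SimpleGraph V} (hb : IsBipartite G) :
    rk G ≤ 2 * matchNum G := by
  obtain ⟨κ, a, ha, hspan, hli⟩ := exists_linearIndependent' ℝ (G.adjMatrix ℝ).row
  have : Fintype κ := Fintype.ofInjective a ha
  have hrk : rk G = (Set.range a).ncard := by
    rw [rk, Matrix.rank_eq_finrank_span_row, ← hspan, finrank_span_eq_card hli,
      ← Set.image_univ, Set.ncard_image_of_injective _ ha, Set.ncard_univ,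
      Nat.card_eq_fintype_card]
  obtain ⟨f, hf, hadj⟩ := exists_injOn_adj_of_linearIndependent (G := G) (t := Set.range a) (by
    have := hli.comp (Equiv.ofInjective a ha).symm (Equiv.injective _)
    have heq : (((G.adjMatrix ℝ).row ∘ a) ∘ (Equiv.ofInjective a ha).symm) =
        fun i : Set.range a => (G.adjMatrix ℝ).row i := by
      ext i
      simp [Equiv.apply_ofInjective_symm]
    exact heq ▸ this)
  obtain ⟨s, hs⟩ := hb
  have h1 := ncard_le_matchNum (t := Set.range a ∩ s) hs Set.inter_subset_right
    (hf.mono Set.inter_subset_left) fun a h => hadj a h.1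
  have h2 := ncard_le_matchNum (s := sᶜ) (t := Set.range a ∩ sᶜ)
    (fun u v h => by have := hs h; simp only [Set.mem_compl_iff]; tauto) Set.inter_subset_right
    (hf.mono Set.inter_subset_left) fun a h => hadj a h.1
  have h3 := Set.ncard_inter_add_ncard_sdiff_eq_ncard (Set.range a) s
  rw [Set.sdiff_eq] at h3
  omega

theorem rk_eq_two_mul_matchNum {G : SimpleGraph V} (hb : IsBipartite G) (hc : C4kFree G) :
    rk G = 2 * matchNum G :=
  (rk_le_two_mul_matchNum hb).antisymm (two_mul_matchNum_le_rk hb hc)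

theorem rk_add_nullity (G : SimpleGraph V) : rk G + nullity G = Fintype.card V := by
  have h := (G.adjMatrix ℝ).mulVecLin.finrank_range_add_finrank_ker
  rwa [Module.finrank_fintype_fun_eq_card] at h

theorem IsBipartite.induce {G : SimpleGraph V} (hb : IsBipartite G) (t : Set V) :
    IsBipartite (G.induce t) := by
  obtain ⟨s, hs⟩ := hb
  exact ⟨{a | (a : V) ∈ s}, fun u v h => hs h⟩

theorem C4kFree.induce {G : SimpleGraph V} (hc : C4kFree G) (t : Set V) :
    C4kFree (G.induce t) := by
  intro v c h hd
  refine hc _ (c.map (Embedding.induce t).toHom)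
    ((Walk.isCycle_map_iff_of_injective Subtype.val_injective).2 h) ?_
  rwa [Walk.length_map]

theorem matchNum_induce_add_one_le {G : SimpleGraph V} {v w : V} (hvw : G.Adj v w) :
    matchNum (G.induce ({v, w}ᶜ : Set V)) + 1 ≤ matchNum G := by
  obtain ⟨M, hM, hcard⟩ := exists_isMatching_ncard_eq_matchNum (G.induce ({v, w}ᶜ : Set V))
  let R : V → V → Prop := fun a b => s(a, b) = s(v, w) ∨
    ∃ a' b' : ({v, w}ᶜ : Set V), M.Adj a' b' ∧ (a' : V) = a ∧ (b' : V) = b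
  have hN : (subgraphOfRel (G := G) R (by
        rintro a b (h | ⟨a, b, h, rfl, rfl⟩)
        · rwa [← mem_edgeSet, h]
        · exact h.adj_sub)
      (by
        rintro a b (h | ⟨a, b, h, rfl, rfl⟩)
        · exact Or.inl (Sym2.eq_swap.trans h)
        · exact Or.inr ⟨b, a, h.symm, rfl, rfl⟩)).IsMatching := by
    refine isMatching_subgraphOfRel ?_
    rintro a b c (h | ⟨a, b, h, rfl, rfl⟩) (h' | ⟨a', c, h', ha, rfl⟩)
    · exact Sym2.congr_right.1 (h.trans h'.symm)
    · have := a'.2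
      grind
    · have := a.2
      grind
    · obtain rfl := Subtype.ext ha
      rw [hM.eq_of_adj_left h h']
  refine le_trans (le_of_eq ?_) (ncard_edgeSet_le_matchNum hN)
  rw [← hcard, ← Set.ncard_image_of_injective M.edgeSet (Sym2.map.injective
    (Subtype.val_injective (p := (· ∈ ({v, w}ᶜ : Set V))))),
    ← Set.ncard_insert_of_notMem (a := s(v, w))]
  · congr 1
    ext e
    induction e with | _ a b
    change s(a, b) = s(v, w) ∨ s(a, b) ∈ Sym2.map Subtype.val '' M.edgeSet ↔
      s(a, b) = s(v, w) ∨ _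
    refine or_congr_right ⟨?_, ?_⟩
    · rintro ⟨e, he, h⟩
      induction e with | _ c d
      rw [Sym2.map_mk, Sym2.eq_iff] at h
      obtain ⟨rfl, rfl⟩ | ⟨rfl, rfl⟩ := h
      exacts [⟨c, d, he, rfl, rfl⟩, ⟨d, c, Subgraph.Adj.symm he, rfl, rfl⟩]
    · rintro ⟨c, d, h, rfl, rfl⟩
      exact ⟨s(c, d), h, rfl⟩
  · rintro ⟨e, he, h⟩
    induction e with | _ a b
    have := a.2
    simp only [Sym2.map_mk] at h
    grind

theorem matchNum_le_matchNum_induce_add_one {G : SimpleGraph V} {M : G.Subgraph}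
    (hM : M.IsMatching) (hcard : M.edgeSet.ncard = matchNum G) {v w : V} (hvw : M.Adj v w) :
    matchNum G ≤ matchNum (G.induce ({v, w}ᶜ : Set V)) + 1 := by
  have hmem : ∀ {a b : V}, M.Adj a b → a ∈ ({v, w}ᶜ : Set V) → b ∈ ({v, w}ᶜ : Set V) := by
    rintro a b hab ha (rfl | rfl)
    · exact ha (Or.inr (hM.eq_of_adj_right hab hvw.symm))
    · exact ha (Or.inl (hM.eq_of_adj_right hab hvw))
  have hN : (M.comap (Embedding.induce ({v, w}ᶜ : Set V)).toHom).IsMatching := by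
    rintro ⟨a, ha⟩ h
    obtain ⟨b, hab, huniq⟩ := hM (show a ∈ M.verts from h)
    exact ⟨⟨b, hmem hab ha⟩, ⟨hab.adj_sub, hab⟩, fun c hc => Subtype.ext (huniq c hc.2)⟩
  rw [← hcard]
  refine le_trans ?_ (Nat.add_le_add_right (ncard_edgeSet_le_matchNum hN) 1)
  rw [← Set.ncard_image_of_injective _ (Sym2.map.injective
    (Subtype.val_injective (p := (· ∈ ({v, w}ᶜ : Set V)))))]
  refine le_trans (Set.ncard_le_ncard fun e he => ?_) (Set.ncard_insert_le s(v, w) _)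
  induction e with | _ a b
  have hab : M.Adj a b := he
  by_cases ha : a ∈ ({v, w}ᶜ : Set V)
  · exact Or.inr ⟨s(⟨a, ha⟩, ⟨b, hmem hab ha⟩), ⟨hab.adj_sub, hab⟩, rfl⟩
  · left
    obtain rfl | rfl := not_not.1 ha
    · rw [hM.eq_of_adj_left hab hvw]
    · rw [hM.eq_of_adj_left hab hvw.symm, Sym2.eq_swap]

/-- deleting a vertex of the N-part together with its matched partner
decreases the matching number by one, keeps the nullity, and decreases the rank by two. -/
theorem stmt15 (G : SimpleGraph V) (hb : IsBipartite G) (hc : C4kFree G)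
    (M : G.Subgraph) (hM : IsMaximumMatching G M)
    (v w : V) (hv : v ∈ npart G) (hw : M.Adj v w) :
    (matchNum (G.induce ({v, w}ᶜ : Set V)) : ℤ) = (matchNum G : ℤ) - 1 ∧
    nullity (G.induce ({v, w}ᶜ : Set V)) = nullity G ∧
    (rk (G.induce ({v, w}ᶜ : Set V)) : ℤ) = (rk G : ℤ) - 2 := by
  have hmax : M.edgeSet.ncard = matchNum G := by
    obtain ⟨N, hN, hcard⟩ := exists_isMatching_ncard_eq_matchNum G
    exact (ncard_edgeSet_le_matchNum hM.1).antisymm (hcard ▸ hM.2 N hN)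
  have h1 := matchNum_induce_add_one_le hw.adj_sub
  have h2 := matchNum_le_matchNum_induce_add_one hM.1 hmax hw
  have h3 := rk_eq_two_mul_matchNum hb hc
  have h4 := rk_eq_two_mul_matchNum (hb.induce ({v, w}ᶜ : Set V)) (hc.induce _)
  have h5 := rk_add_nullity G
  have h6 := rk_add_nullity (G.induce ({v, w}ᶜ : Set V))
  have h7 : Fintype.card ({v, w}ᶜ : Set V) + 2 = Fintype.card V := by
    have h := Set.ncard_add_ncard_compl ({v, w} : Set V)
    rw [Set.ncard_pair hw.ne, Nat.card_eq_fintype_card, ← Nat.card_coe_set_eq,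
      Nat.card_eq_fintype_card] at h
    omega
  refine ⟨by omega, ?_, by omega⟩
  omega

end C4kPaper
end

section
/- If G is a C_{4k}-free bipartite graph, then the subgraph C_S(G) induced by Supp(G) ∪ Core(G) has a unique maximum independent set, namely Supp(G). -/
open scoped Classical

namespace C4kPaper

open SimpleGraph

variable {V : Type*} [Fintype V] [DecidableEq V]

/-- A sequence of consecutively adjacent vertices can be read as a walk. -/
theorem exists_walk_of_seq {W : Type*} (G : SimpleGraph W) (f : ℕ → W)
    (hadj : ∀ i, G.Adj (f i) (f (i + 1)))
    (i m : ℕ) : ∃ p : G.Walk (f i) (f (i + m)), p.length = m ∧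
      p.support = (List.range (m + 1)).map (fun k => f (i + k)) ∧
      ∀ e ∈ p.edges, ∃ k < m, e = s(f (i + k), f (i + k + 1)) := by
  induction m with
  | zero => exact ⟨.nil, by simp⟩
  | succ m ih =>
    obtain ⟨p, hl, hs, he⟩ := ih
    refine ⟨p.concat (hadj (i + m)), by simp [hl], ?_, ?_⟩
    · rw [Walk.support_concat, hs, List.range_succ (n := m + 1)]
      simp
    · intro e h
      rw [Walk.edges_concat, List.concat_eq_append, List.mem_append, List.mem_singleton] at h
      rcases h with h | rfl
      · obtain ⟨k, hk, rfl⟩ := he e h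
        exact ⟨k, by omega, rfl⟩
      · exact ⟨m, by omega, rfl⟩

/-- Sequences of vertices in a bipartite graph alternate between the colour classes. -/
theorem even_of_seq_eq {W : Type*} (G : SimpleGraph W) (hb : IsBipartite G) (f : ℕ → W)
    (hadj : ∀ i, G.Adj (f i) (f (i + 1))) {i n : ℕ} (h : f i = f (i + n)) : Even n := by
  obtain ⟨s, hs⟩ := hb
  have key : ∀ n, (f (i + n) ∈ s ↔ f i ∈ s) ↔ Even n := by
    intro n
    induction n with
    | zero => simp
    | succ n ih =>
      have := hs (hadj (i + n))
      rw [Nat.even_add_one, ← ih, ← Nat.add_assoc]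
      tauto
  rw [← key, h]

/-- An infinite non-backtracking sequence in a `C_{4k}`-free bipartite graph closes up, for the
first time, after a number of steps which is twice an odd number. -/
theorem exists_seq_cycle (G : SimpleGraph V) (hb : IsBipartite G) (hc : C4kFree G) (f : ℕ → V)
    (hadj : ∀ i, G.Adj (f i) (f (i + 1))) (hne : ∀ i, f i ≠ f (i + 2)) :
    ∃ i m, Odd m ∧ 2 ≤ m ∧ f i = f (i + 2 * m) ∧
      ∀ k l, i ≤ k → k < l → l < i + 2 * m → f k ≠ f l := by
  have hex : ∃ j i, i < j ∧ f i = f j := by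
    obtain ⟨a, b, hab, h⟩ := Finite.exists_ne_map_eq_of_infinite f
    rcases lt_or_gt_of_ne hab with h' | h'
    · exact ⟨b, a, h', h⟩
    · exact ⟨a, b, h', h.symm⟩
  obtain ⟨i, hij, hf⟩ := Nat.find_spec hex
  have hmin : ∀ l < Nat.find hex, ∀ k < l, f k ≠ f l := fun l hl k hk h =>
    Nat.find_min hex hl ⟨k, hk, h⟩
  generalize Nat.find hex = j at hij hf hmin
  obtain ⟨n, rfl⟩ := Nat.exists_eq_add_of_lt hij
  obtain ⟨m, hm⟩ := even_of_seq_eq G hb f hadj (i := i) (n := n + 1) hf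
  have hn : n + 1 = 2 * m := by omega
  have hm2 : 2 ≤ m := by
    by_contra h
    obtain rfl : n = 1 := by omega
    exact hne i hf
  refine ⟨i, m, ?_, hm2, by rw [← hn]; exact hf, fun k l _ hkl hl => hmin l (by omega) k hkl⟩
  obtain ⟨p, hl, hs, he⟩ := exists_walk_of_seq G f hadj i n
  have hclose : G.Adj (f (i + n)) (f i) := by
    rw [hf]
    exact hadj (i + n)
  have hcyc : (Walk.cons hclose p).IsCycle := by
    rw [Walk.cons_isCycle_iff]
    constructor
    · rw [Walk.isPath_def, hs]
      refine List.Nodup.map_on ?_ List.nodup_range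
      intro a ha b hb hab
      simp only [List.mem_range] at ha hb
      by_contra hne'
      rcases lt_or_gt_of_ne hne' with h | h
      · exact hmin (i + b) (by omega) (i + a) (by omega) hab
      · exact hmin (i + a) (by omega) (i + b) (by omega) hab.symm
    · intro h
      obtain ⟨k, hk, h⟩ := he _ h
      rw [Sym2.eq_iff] at h
      rcases h with ⟨h, -⟩ | ⟨h, h'⟩
      · exact hmin (i + n) (by omega) (i + k) (by omega) h.symm
      · obtain rfl | hk0 := Nat.eq_zero_or_pos k
        · exact hmin (i + n) (by omega) (i + 0 + 1) (by omega) h.symm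
        · exact hmin (i + k) (by omega) i (by omega) h'
  have h4 := hc _ _ hcyc
  rw [Walk.length_cons, hl, hn] at h4
  rw [← Nat.not_even_iff_odd]
  rintro ⟨r, rfl⟩
  exact h4 ⟨r, by ring⟩

/-- A real sequence whose consecutive terms have opposite signs has terms of equal sign only at
even distance. -/
theorem even_of_alternating {a : ℕ → ℝ} (h : ∀ i, a i * a (i + 1) < 0) {i m : ℕ}
    (heq : a i = a (i + m)) : Even m := by
  have key : ∀ m, (0 < a (i + m) * a i ↔ Even m) ∧ a (i + m) * a i ≠ 0 := by
    intro m
    induction m with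
    | zero =>
      have h0 : a i ≠ 0 := fun h0 => by simpa [h0] using h i
      simpa using h0
    | succ m ih =>
      obtain ⟨ih, h0⟩ := ih
      have h1 := h (i + m)
      have hi : a i ≠ 0 := right_ne_zero_of_mul h0
      have hneg : (a (i + m) * a i) * (a (i + (m + 1)) * a i) < 0 := by
        have : 0 < a i * a i := mul_self_pos.mpr hi
        rw [← Nat.add_assoc]
        nlinarith
      rw [Nat.even_add_one, ← ih]
      refine ⟨⟨fun hp hq => by nlinarith, fun hq => ?_⟩, right_ne_zero_of_mul hneg.ne⟩
      rcases lt_or_gt_of_ne h0 with h' | h'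
      · exact pos_of_mul_neg_right hneg h'.le
      · exact absurd h' hq
  rw [← (key m).1, ← heq]
  exact mul_self_pos.mpr (right_ne_zero_of_mul (key 0).2)

/-- Some null vector is nonzero on the whole support. -/
theorem exists_mem_nullSet_forall_ne_zero {W : Type*} [Fintype W] (G : SimpleGraph W) :
    ∃ x ∈ nullSet G, ∀ v, v ∈ supp G ↔ x v ≠ 0 := by
  obtain ⟨x, hx, h⟩ := Module.Dual.exists_forall_mem_ne_zero_of_forall_exists (nullModule G)
    (fun v : supp G => (LinearMap.proj (v : W) : (W → ℝ) →ₗ[ℝ] ℝ)) (fun v => by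
      obtain ⟨y, hy, hyv⟩ := v.2
      exact ⟨y, by simpa [nullModule, nullSet] using hy, hyv⟩)
  have hx' : x ∈ nullSet G := by simpa [nullModule, nullSet] using hx
  exact ⟨x, hx', fun v => ⟨fun hv => h ⟨v, hv⟩, fun hv => ⟨x, hx', hv⟩⟩⟩

/-- A neighbour of a nonzero entry of a null vector sees a positive and a negative entry. -/
theorem exists_adj_pos_neg {W : Type*} [Fintype W] {G : SimpleGraph W} {x : W → ℝ}
    (hx : x ∈ nullSet G) {c v : W}
    (hcv : G.Adj c v) (hv : x v ≠ 0) :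
    (∃ p, G.Adj c p ∧ 0 < x p) ∧ ∃ n, G.Adj c n ∧ x n < 0 := by
  have hsum : ∑ u ∈ G.neighborFinset c, x u = 0 := by
    rw [← adjMatrix_mulVec_apply]
    exact congrFun hx c
  have hmem : v ∈ G.neighborFinset c := by simpa using hcv
  constructor
  · obtain ⟨p, hp, h⟩ := Finset.exists_pos_of_sum_zero_of_exists_nonzero x hsum ⟨v, hmem, hv⟩
    exact ⟨p, by simpa using hp, h⟩
  · obtain ⟨p, hp, h⟩ := Finset.exists_pos_of_sum_zero_of_exists_nonzero (fun u => -x u)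
      (by simp [hsum]) ⟨v, hmem, by simpa using hv⟩
    exact ⟨p, by simpa using hp, by simpa using h⟩

/-- The support of a `C_{4k}`-free bipartite graph is independent. -/
theorem isIndep_supp (G : SimpleGraph V) (hb : IsBipartite G) (hc : C4kFree G) :
    IsIndep G (supp G) := by
  intro v hv w hw hvw
  obtain ⟨x, hx, hsupp⟩ := exists_mem_nullSet_forall_ne_zero G
  let State := {q : V × V // G.Adj q.1 q.2 ∧ x q.1 ≠ 0 ∧ x q.2 ≠ 0}
  have hstep : ∀ q : State, ∃ q' : State, q'.1.1 = q.1.2 ∧ x q.1.1 * x q'.1.2 < 0 := by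
    rintro ⟨⟨a, b⟩, hab, ha, hb'⟩
    obtain ⟨⟨p, hp, hp0⟩, n, hn, hn0⟩ := exists_adj_pos_neg hx hab.symm ha
    rcases lt_or_gt_of_ne ha with h | h
    · exact ⟨⟨(b, p), hp, hb', hp0.ne'⟩, rfl, mul_neg_of_neg_of_pos h hp0⟩
    · exact ⟨⟨(b, n), hn, hb', hn0.ne⟩, rfl, mul_neg_of_pos_of_neg h hn0⟩
  choose next hnext hsign using hstep
  let q : ℕ → State := fun k => next^[k] ⟨(v, w), hvw, (hsupp v).1 hv, (hsupp w).1 hw⟩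
  have hq : ∀ k, q (k + 1) = next (q k) := fun k => Function.iterate_succ_apply' _ _ _
  let f : ℕ → V := fun k => (q k).1.1
  have hf1 : ∀ k, f (k + 1) = (q k).1.2 := fun k => by
    change (q (k + 1)).1.1 = _
    rw [hq, hnext]
  have hadj : ∀ k, G.Adj (f k) (f (k + 1)) := fun k => by
    rw [hf1]
    exact (q k).2.1
  have hneg : ∀ k, x (f k) * x (f (k + 2)) < 0 := fun k => by
    rw [hf1, hq]
    exact hsign (q k)
  obtain ⟨i, m, hodd, -, heq, -⟩ := exists_seq_cycle G hb hc f hadj fun k h => by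
    have := hneg k
    rw [← h] at this
    exact absurd this (mul_self_nonneg _).not_gt
  have := even_of_alternating (a := fun k => x (f (i + 2 * k))) (fun k => hneg (i + 2 * k))
    (i := 0) (m := m) (by simpa using congrArg x heq)
  exact Nat.not_even_iff_odd.2 hodd this

/-- A multigraph with at least as many edges as vertices and without loops has a nonempty set of
edges, each endpoint of which is shared with another edge of the set. -/
theorem exists_subset_no_leaf {α β : Type*} [DecidableEq α] [DecidableEq β] (p n : α → β)
    (A : Finset α) (B : Finset β) (hA : A.Nonempty) (hp : ∀ a ∈ A, p a ∈ B) (hn : ∀ a ∈ A, n a ∈ B)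
    (hpn : ∀ a ∈ A, p a ≠ n a) (hcard : B.card ≤ A.card) :
    ∃ A' ⊆ A, A'.Nonempty ∧ ∀ a ∈ A', ∀ b, (b = p a ∨ b = n a) →
      ∃ a' ∈ A', a' ≠ a ∧ (b = p a' ∨ b = n a') := by
  induction A using Finset.strongInduction generalizing B with
  | H A ih =>
    by_cases hgood : ∀ a ∈ A, ∀ b, (b = p a ∨ b = n a) →
        ∃ a' ∈ A, a' ≠ a ∧ (b = p a' ∨ b = n a')
    · exact ⟨A, subset_rfl, hA, hgood⟩
    push Not at hgood
    obtain ⟨a, ha, b, hb, hleaf⟩ := hgood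
    have hbB : b ∈ B := by
      rcases hb with rfl | rfl
      exacts [hp a ha, hn a ha]
    have hne : (A.erase a).Nonempty := by
      rw [← Finset.card_pos, Finset.card_erase_of_mem ha]
      have : 1 < B.card := Finset.one_lt_card.2 ⟨p a, hp a ha, n a, hn a ha, hpn a ha⟩
      omega
    obtain ⟨A', hsub, h⟩ := ih (A.erase a) (Finset.erase_ssubset ha) (B.erase b) hne
      (fun c hc => Finset.mem_erase.2 ⟨fun h => (hleaf c (Finset.mem_of_mem_erase hc)
        (Finset.ne_of_mem_erase hc)).1 h.symm, hp c (Finset.mem_of_mem_erase hc)⟩)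
      (fun c hc => Finset.mem_erase.2 ⟨fun h => (hleaf c (Finset.mem_of_mem_erase hc)
        (Finset.ne_of_mem_erase hc)).2 h.symm, hn c (Finset.mem_of_mem_erase hc)⟩)
      (fun c hc => hpn c (Finset.mem_of_mem_erase hc))
      (by rw [Finset.card_erase_of_mem ha, Finset.card_erase_of_mem hbB]; omega)
    exact ⟨A', hsub.trans (Finset.erase_subset _ _), h⟩

/-- In a `C_{4k}`-free bipartite graph, if every vertex of a nonempty set `A` has neighbours of
both signs in `B`, then `B` is larger than `A`. -/
theorem card_lt_card_of_adj_pos_neg (G : SimpleGraph V) (hb : IsBipartite G) (hc : C4kFree G)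
    (x : V → ℝ) (A B : Finset V) (hA : A.Nonempty)
    (hp : ∀ a ∈ A, ∃ b ∈ B, G.Adj a b ∧ 0 < x b) (hn : ∀ a ∈ A, ∃ b ∈ B, G.Adj a b ∧ x b < 0) :
    A.card < B.card := by
  by_contra! hcard
  choose! p hpB hpadj hppos using hp
  choose! n hnB hnadj hnneg using hn
  obtain ⟨A', hsub, ⟨a₀, ha₀⟩, hA'⟩ := exists_subset_no_leaf p n A B hA hpB hnB
    (fun a ha h => by have := hppos a ha; rw [h] at this; exact this.not_gt (hnneg a ha)) hcard
  let State := {q : V × V // q.2 ∈ A' ∧ (q.1 = p q.2 ∨ q.1 = n q.2)}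
  have hstep : ∀ q : State, ∃ q' : State, (q'.1.1 = p q.1.2 ∨ q'.1.1 = n q.1.2) ∧ q'.1.2 ≠ q.1.2 ∧
      x q.1.1 * x q'.1.1 < 0 := by
    rintro ⟨⟨b, a⟩, ha, hba⟩
    dsimp only at ha hba
    have hx1 := hppos a (hsub ha)
    have hx2 := hnneg a (hsub ha)
    rcases hba with rfl | rfl
    · obtain ⟨a', ha', hne, h⟩ := hA' a ha (n a) (.inr rfl)
      exact ⟨⟨(n a, a'), ha', h⟩, .inr rfl, hne, mul_neg_of_pos_of_neg hx1 hx2⟩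
    · obtain ⟨a', ha', hne, h⟩ := hA' a ha (p a) (.inl rfl)
      exact ⟨⟨(p a, a'), ha', h⟩, .inl rfl, hne, mul_neg_of_neg_of_pos hx2 hx1⟩
  choose next hother hne hsign using hstep
  let q : ℕ → State := fun k => next^[k] ⟨(p a₀, a₀), ha₀, .inl rfl⟩
  have hq : ∀ k, q (k + 1) = next (q k) := fun k => Function.iterate_succ_apply' _ _ _
  have hqneg : ∀ k, x (q k).1.1 * x (q (k + 1)).1.1 < 0 := fun k => by
    rw [hq]
    exact hsign (q k)
  have hqadj : ∀ k, G.Adj (q k).1.1 (q k).1.2 := fun k => by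
    obtain ⟨hmem, h | h⟩ := (q k).2
    · rw [h]
      exact (hpadj _ (hsub hmem)).symm
    · rw [h]
      exact (hnadj _ (hsub hmem)).symm
  let f : ℕ → V := fun k => if Even k then (q (k / 2)).1.1 else (q (k / 2)).1.2
  have hf0 : ∀ k, f (2 * k) = (q k).1.1 := fun k => by simp [f]
  have hf1 : ∀ k, f (2 * k + 1) = (q k).1.2 := fun k => by
    have h : (2 * k + 1) / 2 = k := by omega
    simp [f, h]
  obtain ⟨i, m, hodd, hm, heq, hinj⟩ := exists_seq_cycle G hb hc f
    (fun k => by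
      obtain ⟨r, rfl | rfl⟩ := Nat.even_or_odd' k
      · rw [hf0, hf1]
        exact hqadj r
      · rw [hf1, show 2 * r + 1 + 1 = 2 * (r + 1) by ring, hf0, hq]
        rcases hother (q r) with h | h
        · rw [h]
          exact hpadj _ (hsub (q r).2.1)
        · rw [h]
          exact hnadj _ (hsub (q r).2.1))
    (fun k => by
      obtain ⟨r, rfl | rfl⟩ := Nat.even_or_odd' k
      · rw [show 2 * r + 2 = 2 * (r + 1) by ring, hf0, hf0]
        intro h
        have := hqneg r
        rw [← h] at this
        exact this.not_ge (mul_self_nonneg _)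
      · rw [show 2 * r + 1 + 2 = 2 * (r + 1) + 1 by ring, hf1, hf1, hq]
        exact (hne (q r)).symm)
  have hnot : ∀ r, x (q r).1.1 ≠ x (q (r + m)).1.1 := fun r h =>
    Nat.not_even_iff_odd.2 hodd (even_of_alternating (a := fun k => x (q k).1.1) hqneg h)
  obtain ⟨r, rfl | rfl⟩ := Nat.even_or_odd' i
  · rw [← Nat.mul_add, hf0, hf0] at heq
    exact hnot r (by rw [heq])
  · rw [show 2 * r + 1 + 2 * m = 2 * (r + m) + 1 by ring, hf1, hf1] at heq
    refine hinj (2 * (r + 1)) (2 * (r + m)) (by omega) (by omega) (by omega) ?_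
    rw [hf0, hf0]
    have hends : ∀ k, ((q k).1.1 = p (q k).1.2 ∧ (q (k + 1)).1.1 = n (q k).1.2) ∨
        ((q k).1.1 = n (q k).1.2 ∧ (q (k + 1)).1.1 = p (q k).1.2) := by
      intro k
      have hadv : (q (k + 1)).1.1 = p (q k).1.2 ∨ (q (k + 1)).1.1 = n (q k).1.2 := by
        rw [hq]
        exact hother (q k)
      have hneg := hqneg k
      rcases (q k).2.2 with h | h <;> rcases hadv with h' | h'
      · rw [h, h'] at hneg
        exact absurd hneg (mul_self_nonneg _).not_gt
      · exact .inl ⟨h, h'⟩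
      · exact .inr ⟨h, h'⟩
      · rw [h, h'] at hneg
        exact absurd hneg (mul_self_nonneg _).not_gt
    have h1 := hends r
    have h2 := (q (r + m)).2.2
    have h3 := hnot r
    rw [← heq] at h2
    rcases h1 with ⟨h1, h1'⟩ | ⟨h1, h1'⟩ <;> rcases h2 with h2 | h2 <;>
      first
      | exact absurd (congrArg x (h1.trans h2.symm)) h3
      | exact h1'.trans h2.symm

/-- An independent subset of `supp G ∪ core G` other than `supp G` is smaller than `supp G`. -/
theorem ncard_lt_ncard_supp (G : SimpleGraph V) (hb : IsBipartite G) (hc : C4kFree G) {t : Set V}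
    (hsub : t ⊆ supp G ∪ core G) (ht : IsIndep G t) (hne : t ≠ supp G) :
    t.ncard < (supp G).ncard := by
  by_cases hts : t ⊆ supp G
  · exact Set.ncard_lt_ncard (hts.ssubset_of_ne hne)
  obtain ⟨x, hx, hsupp⟩ := exists_mem_nullSet_forall_ne_zero G
  have hpn : ∀ a ∈ t \ supp G,
      (∃ p, G.Adj a p ∧ 0 < x p) ∧ ∃ n, G.Adj a n ∧ x n < 0 := by
    rintro a ⟨ha, has⟩
    obtain ⟨v, hv, hav⟩ := (hsub ha).resolve_left has
    exact exists_adj_pos_neg hx hav ((hsupp v).1 hv)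
  have hlt := card_lt_card_of_adj_pos_neg G hb hc x (t \ supp G).toFinset (supp G \ t).toFinset
    (Set.toFinset_nonempty.2 (Set.sdiff_nonempty.2 hts))
    (fun a ha => by
      rw [Set.mem_toFinset] at ha
      obtain ⟨b, hab, hb0⟩ := (hpn a ha).1
      exact ⟨b, Set.mem_toFinset.2 ⟨(hsupp b).2 hb0.ne', fun hbt => ht ha.1 hbt hab⟩, hab, hb0⟩)
    (fun a ha => by
      rw [Set.mem_toFinset] at ha
      obtain ⟨b, hab, hb0⟩ := (hpn a ha).2
      exact ⟨b, Set.mem_toFinset.2 ⟨(hsupp b).2 hb0.ne, fun hbt => ht ha.1 hbt hab⟩, hab, hb0⟩)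
  rw [← Set.ncard_eq_toFinset_card', ← Set.ncard_eq_toFinset_card'] at hlt
  have h1 := Set.ncard_inter_add_ncard_sdiff_eq_ncard t (supp G)
  have h2 := Set.ncard_inter_add_ncard_sdiff_eq_ncard (supp G) t
  rw [Set.inter_comm] at h2
  omega

/-- `C_S(G)` has a unique maximum independent set, namely `Supp(G)`. -/
theorem stmt17 (G : SimpleGraph V) (hb : IsBipartite G) (hc : C4kFree G) :
    ∀ s : Set (supp G ∪ core G : Set V),
      IsMaxIndep (G.induce (supp G ∪ core G)) s ↔
        s = {u : (supp G ∪ core G : Set V) | (u : V) ∈ supp G} := by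
  have hval : Subtype.val '' {u : (supp G ∪ core G : Set V) | (u : V) ∈ supp G} = supp G := by
    ext v
    simp only [Set.mem_image, Set.mem_ofPred_eq, Subtype.exists, exists_and_left, exists_prop,
      exists_eq_right_right]
    exact and_iff_left_of_imp .inl
  have hncard : ∀ t : Set (supp G ∪ core G : Set V), (Subtype.val '' t).ncard = t.ncard :=
    fun t => Set.ncard_image_of_injective t Subtype.val_injective
  have hlt : ∀ t : Set (supp G ∪ core G : Set V), IsIndep (G.induce (supp G ∪ core G)) t →
      t ≠ {u : (supp G ∪ core G : Set V) | (u : V) ∈ supp G} →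
      t.ncard < {u : (supp G ∪ core G : Set V) | (u : V) ∈ supp G}.ncard := by
    intro t ht hne
    rw [← hncard, ← hncard {u : (supp G ∪ core G : Set V) | (u : V) ∈ supp G}, hval]
    refine ncard_lt_ncard_supp G hb hc (Subtype.coe_image_subset _ t) ?_ ?_
    · rintro _ ⟨u, hu, rfl⟩ _ ⟨w, hw, rfl⟩ huw
      exact ht hu hw huw
    · exact fun h => hne (Subtype.val_injective.image_injective (h.trans hval.symm))
  have hindep : IsIndep (G.induce (supp G ∪ core G))
      {u : (supp G ∪ core G : Set V) | (u : V) ∈ supp G} :=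
    fun u hu w hw huw => isIndep_supp G hb hc hu hw huw
  intro s
  constructor
  · intro hs
    by_contra hne
    exact (hs.2 _ hindep).not_gt (hlt s hs.1 hne)
  · rintro rfl
    refine ⟨hindep, fun t ht => ?_⟩
    by_cases h : t = {u : (supp G ∪ core G : Set V) | (u : V) ∈ supp G}
    · rw [h]
    · exact (hlt t ht h).le

end C4kPaper
end

section
/- Let G be a C_{4k}-free bipartite graph. Then Supp(G) is exactly the set of vertices belonging to every maximum independent set of G, Core(G) is exactly the set of vertices belonging to no maximum independent set, and Npart(G) is exactly the set of vertices belonging to some but not all maximum independent sets. -/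
open scoped Classical

namespace C4kPaper

open SimpleGraph

variable {V : Type*} [Fintype V] [DecidableEq V]

/-- A closed sequence of `n ≥ 3` distinct, consecutively adjacent vertices yields a cycle of
length `n`. -/
lemma exists_isCycle_of_seq {W : Type*} {G : SimpleGraph W} {n : ℕ} (hn : 2 < n) (g : ℕ → W)
    (hadj : ∀ m, G.Adj (g m) (g (m + 1))) (hclose : g n = g 0)
    (hinj : ∀ m < n, ∀ m' < n, g m = g m' → m = m') :
    ∃ (v : W) (c : G.Walk v v), c.IsCycle ∧ c.length = n := by
  refine (cycleGraph_isContained_iff hn).mp ⟨⟨⟨fun m => g m, ?_⟩, ?_⟩⟩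
  · have key : ∀ u v : Fin n, (v - u).val = 1 → G.Adj (g u) (g v) := by
      intro u v h
      have hu := u.isLt
      have hv := v.isLt
      rw [Fin.sub_def] at h
      simp only at h
      have hcases : v.val = u.val + 1 ∨ (u.val + 1 = n ∧ v.val = 0) := by
        rcases Nat.lt_or_ge (n - u.val + v.val) n with h' | h'
        · rw [Nat.mod_eq_of_lt h'] at h
          omega
        · rw [Nat.mod_eq_sub_mod h', Nat.mod_eq_of_lt (by omega)] at h
          omega
      rcases hcases with h' | ⟨h', h''⟩
      · rw [h']
        exact hadj u
      · have := hadj u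
        rwa [h', hclose, ← h''] at this
    intro u v h
    rw [cycleGraph_adj'] at h
    rcases h with h | h
    · exact (key v u h).symm
    · exact key u v h
  · intro u v h
    exact Fin.ext (hinj u u.isLt v v.isLt h)

/-- A permutation carrying one perfect matching of a `C_{4k}`-free graph to another has only
cycles of odd length. -/
lemma odd_of_mem_cycleType {W ι : Type*} [Fintype ι] [DecidableEq ι] {G : SimpleGraph W}
    (hc : C4kFree G) {a b : ι → W} (ha : Function.Injective a) (hb : Function.Injective b)
    (hab : ∀ i j, a i ≠ b j) (hadj : ∀ i, G.Adj (a i) (b i)) {σ : Equiv.Perm ι}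
    (hσ : ∀ i, G.Adj (a (σ i)) (b i)) {k : ℕ} (hk : k ∈ σ.cycleType) : Odd k := by
  by_contra hodd
  rw [Nat.not_odd_iff_even] at hodd
  have hk2 : 2 ≤ k := Equiv.Perm.two_le_of_mem_cycleType hk
  rw [Equiv.Perm.cycleType_def, Multiset.mem_map] at hk
  obtain ⟨c, hcσ, hck⟩ := hk
  have hon := Equiv.Perm.isCycleOn_support_of_mem_cycleFactorsFinset hcσ
  obtain ⟨i, hi⟩ : c.support.Nonempty := by
    rw [← Finset.card_pos]
    simp only [Function.comp_apply] at hck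
    omega
  simp only [Function.comp_apply] at hck
  have hpow : ∀ p < k, ∀ q < k, (σ ^ p) i = (σ ^ q) i → p = q := by
    intro p hp q hq h
    rw [hon.pow_apply_eq_pow_apply hi, hck] at h
    exact Nat.ModEq.eq_of_lt_of_lt h hp hq
  have hclose : (σ ^ k) i = i := by
    rw [← hck]
    exact hon.pow_card_apply hi
  obtain ⟨v, w, hw, hlen⟩ := exists_isCycle_of_seq (G := G) (n := 2 * k) (by omega)
    (fun m => if Even m then a ((σ ^ (m / 2)) i) else b ((σ ^ (m / 2)) i)) (by
      intro m
      rcases Nat.even_or_odd' m with ⟨j, rfl | rfl⟩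
      · have h1 : (2 * j + 1) / 2 = j := by omega
        simp [h1, hadj]
      · have h1 : (2 * j + 1) / 2 = j := by omega
        have h2 : (2 * j + 1 + 1) / 2 = j + 1 := by omega
        have h3 : Even (2 * j + 1 + 1) := ⟨j + 1, by ring⟩
        simp only [h1, h2, h3, if_true, Nat.not_even_bit1, if_false, pow_succ',
          Equiv.Perm.mul_apply]
        exact (hσ _).symm) (by simp [hclose]) (by
      intro m hm m' hm' h
      rcases Nat.even_or_odd' m with ⟨j, rfl | rfl⟩ <;>
        rcases Nat.even_or_odd' m' with ⟨l, rfl | rfl⟩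
      · simp only [even_two_mul, if_true] at h
        have := hpow _ (by omega) _ (by omega) (ha h)
        omega
      · simp only [even_two_mul, if_true, Nat.not_even_bit1, if_false] at h
        exact (hab _ _ h).elim
      · simp only [even_two_mul, if_true, Nat.not_even_bit1, if_false] at h
        exact (hab _ _ h.symm).elim
      · simp only [Nat.not_even_bit1, if_false] at h
        have := hpow _ (by omega) _ (by omega) (hb h)
        omega)
  refine hc v w hw ?_
  obtain ⟨r, rfl⟩ := hodd
  exact ⟨r, by omega⟩

lemma sign_eq_one_of_odd_cycleType {ι : Type*} [Fintype ι] [DecidableEq ι] {σ : Equiv.Perm ι}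
    (h : ∀ k ∈ σ.cycleType, Odd k) : Equiv.Perm.sign σ = 1 := by
  rw [Equiv.Perm.sign_of_cycleType']
  refine Multiset.prod_eq_one fun x hx => ?_
  obtain ⟨k, hk, rfl⟩ := Multiset.mem_map.mp hx
  simp [(h k hk).neg_one_pow]

/-- In a `C_{4k}`-free graph, a square bipartite adjacency matrix supporting a perfect matching
is nonsingular. -/
lemma det_ne_zero_of_matching {W ι : Type*} [Fintype ι] [DecidableEq ι] {G : SimpleGraph W}
    (hc : C4kFree G) {a b : ι → W} (ha : Function.Injective a) (hb : Function.Injective b)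
    (hab : ∀ i j, a i ≠ b j) (hadj : ∀ i, G.Adj (a i) (b i)) :
    (Matrix.of fun i j => if G.Adj (a i) (b j) then (1 : ℝ) else 0).det ≠ 0 := by
  refine ne_of_gt ?_
  rw [Matrix.det_apply']
  refine Finset.sum_pos' (fun σ _ => ?_) ⟨1, Finset.mem_univ _, by simp [hadj]⟩
  by_cases hσ : ∀ i, G.Adj (a (σ i)) (b i)
  · rw [sign_eq_one_of_odd_cycleType fun k hk => odd_of_mem_cycleType hc ha hb hab hadj hσ hk]
    simp [hσ]
  · push Not at hσ
    obtain ⟨i, hi⟩ := hσ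
    rw [Finset.prod_eq_zero (Finset.mem_univ i) (by simp [hi])]
    simp

/-- The neighbours inside `I` of a set `T`. -/
noncomputable def nbrsIn (G : SimpleGraph V) (I : Set V) (T : Finset V) : Finset V :=
  T.biUnion fun w => Finset.univ.filter fun u => u ∈ I ∧ G.Adj w u

lemma mem_nbrsIn {G : SimpleGraph V} {I : Set V} {T : Finset V} {u : V} :
    u ∈ nbrsIn G I T ↔ u ∈ I ∧ ∃ w ∈ T, G.Adj w u := by
  simp only [nbrsIn, Finset.mem_biUnion, Finset.mem_filter, Finset.mem_univ, true_and]
  tauto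

/-- Exchanging the neighbours of an outside independent set `T` for `T` itself. -/
lemma exchange_s18 {G : SimpleGraph V} {I : Set V} (hI : IsIndep G I) {T : Finset V}
    (hT : IsIndep G (T : Set V)) (hdisj : ∀ w ∈ T, w ∉ I) :
    IsIndep G (I \ nbrsIn G I T ∪ T) ∧
      (I \ nbrsIn G I T ∪ T).ncard + (nbrsIn G I T).card = I.ncard + T.card := by
  constructor
  · rintro u (⟨hu, hu'⟩ | hu) w (⟨hw, hw'⟩ | hw) h
    · exact hI hu hw h
    · exact hu' (mem_nbrsIn.mpr ⟨hu, w, hw, h.symm⟩)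
    · exact hw' (mem_nbrsIn.mpr ⟨hw, u, hu, h⟩)
    · exact hT hu hw h
  · have hsub : (nbrsIn G I T : Set V) ⊆ I := fun u hu => (mem_nbrsIn.mp hu).1
    rw [Set.ncard_union_eq (Set.disjoint_left.mpr fun u hu hu' => hdisj u hu' hu.1)
      (Set.toFinite _) (Set.toFinite _), Set.ncard_coe_finset]
    have := Set.ncard_sdiff_add_ncard_of_subset hsub (Set.toFinite _)
    rw [Set.ncard_coe_finset] at this
    omega

lemma IsMaxIndep.card_le_card_nbrsIn {G : SimpleGraph V} {I : Set V} (hI : IsMaxIndep G I)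
    {T : Finset V} (hT : IsIndep G (T : Set V)) (hdisj : ∀ w ∈ T, w ∉ I) :
    T.card ≤ (nbrsIn G I T).card := by
  obtain ⟨h1, h2⟩ := exchange_s18 hI.1 hT hdisj
  have := hI.2 _ h1
  omega

/-- A vertex lying in every maximum independent set can be avoided in Hall's condition. -/
lemma IsMaxIndep.card_le_card_erase_nbrsIn {G : SimpleGraph V} {I : Set V} (hI : IsMaxIndep G I)
    {v : V} (hv : ∀ s, IsMaxIndep G s → v ∈ s) {T : Finset V} (hT : IsIndep G (T : Set V))
    (hdisj : ∀ w ∈ T, w ∉ I) : T.card ≤ ((nbrsIn G I T).erase v).card := by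
  have hle := hI.card_le_card_nbrsIn hT hdisj
  by_cases hvN : v ∈ nbrsIn G I T
  · rw [Finset.card_erase_of_mem hvN]
    by_contra hlt
    obtain ⟨h1, h2⟩ := exchange_s18 hI.1 hT hdisj
    have hmax : IsMaxIndep G (I \ nbrsIn G I T ∪ T) := by
      refine ⟨h1, fun t ht => ?_⟩
      have := hI.2 t ht
      omega
    rcases hv _ hmax with h | h
    · exact h.2 hvN
    · exact hdisj v h (hv I hI)
  · rwa [Finset.erase_eq_of_notMem hvN]

lemma exists_isMaxIndep {W : Type*} [Finite W] (G : SimpleGraph W) : ∃ s, IsMaxIndep G s := by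
  obtain ⟨s, hs, hmax⟩ := Set.exists_max_image {s : Set W | IsIndep G s} Set.ncard
    (Set.toFinite _) ⟨∅, by simp [IsIndep]⟩
  exact ⟨s, hs, hmax⟩

lemma mem_nullSet_iff_s18 {W : Type*} [Fintype W] {G : SimpleGraph W} {x : W → ℝ} :
    x ∈ nullSet G ↔ ∀ w, ∑ u, (if G.Adj w u then x u else 0) = 0 := by
  simp only [nullSet, Set.mem_ofPred_eq, funext_iff, Matrix.mulVec, dotProduct,
    SimpleGraph.adjMatrix_apply, ite_mul, one_mul, zero_mul, Pi.zero_apply]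

section Bipartite

variable {G : SimpleGraph V} {A : Set V}

lemma isIndep_of_subset {W : Type*} {G : SimpleGraph W} {A : Set W}
    (hA : ∀ ⦃u v : W⦄, G.Adj u v → (u ∈ A ↔ v ∉ A)) {T : Set W}
    (hT : T ⊆ A) : IsIndep G T :=
  fun _ hu _ hw h => (hA h).mp (hT hu) (hT hw)

lemma bipartition_compl {W : Type*} {G : SimpleGraph W} {A : Set W}
    (hA : ∀ ⦃u v : W⦄, G.Adj u v → (u ∈ A ↔ v ∉ A)) :
    ∀ ⦃u v : W⦄, G.Adj u v → (u ∈ Aᶜ ↔ v ∉ Aᶜ) := by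
  intro u v h
  have := hA h
  simp only [Set.mem_compl_iff]
  tauto

lemma mem_of_mem_supp (hA : ∀ ⦃u v : V⦄, G.Adj u v → (u ∈ A ↔ v ∉ A)) (hc : C4kFree G)
    {v : V} (hvA : v ∈ A) (hv : v ∈ supp G) {I : Set V} (hI : IsMaxIndep G I) : v ∈ I := by
  by_contra hvI
  obtain ⟨x, hx, hxv⟩ := hv
  rw [mem_nullSet_iff_s18] at hx
  let S := {u : V // u ∈ A ∧ u ∉ I}
  obtain ⟨f, hf, hfmem⟩ := (Finset.all_card_le_biUnion_card_iff_exists_injective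
    (fun w : S => Finset.univ.filter fun u => u ∈ I ∧ G.Adj w u)).mp (by
      intro T
      have h := hI.card_le_card_nbrsIn (T := T.map (Function.Embedding.subtype _))
        (isIndep_of_subset hA (by
          intro u hu
          obtain ⟨w, -, rfl⟩ := Finset.mem_map.mp hu
          exact w.2.1)) (by
          intro u hu
          obtain ⟨w, -, rfl⟩ := Finset.mem_map.mp hu
          exact w.2.2)
      rw [Finset.card_map] at h
      refine h.trans_eq (congrArg _ ?_)
      ext u
      simp only [mem_nbrsIn, Finset.mem_map, Finset.mem_biUnion, Finset.mem_filter,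
        Finset.mem_univ, true_and, Function.Embedding.subtype_apply]
      constructor
      · rintro ⟨h1, _, ⟨w, hw, rfl⟩, h2⟩
        exact ⟨w, hw, h1, h2⟩
      · rintro ⟨w, hw, h1, h2⟩
        exact ⟨h1, w, ⟨w, hw, rfl⟩, h2⟩)
  simp only [Finset.mem_filter, Finset.mem_univ, true_and] at hfmem
  have hdet := det_ne_zero_of_matching hc (a := fun w : S => (w : V)) (b := f)
    Subtype.val_injective hf
    (fun i j h => i.2.2 (h ▸ (hfmem j).1)) (fun i => (hfmem i).2)
  have hzero := Matrix.eq_zero_of_vecMul_eq_zero hdet (v := fun w : S => x w) (by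
    funext j
    simp only [Matrix.vecMul, dotProduct, Matrix.of_apply, mul_ite, mul_one, mul_zero,
      Pi.zero_apply]
    refine Eq.trans ?_ (hx (f j))
    rw [← Finset.sum_subset (Finset.subset_univ (Finset.univ.filter fun u => u ∈ A ∧ u ∉ I))
      (fun u _ hu => if_neg fun h => hu ?_),
      Finset.sum_subtype (p := fun u => u ∈ A ∧ u ∉ I) _ (by simp)]
    · exact Finset.sum_congr rfl fun w _ => by simp only [G.adj_comm]
    · have hfA : f j ∉ A := (hA (hfmem j).2).mp j.2.1
      have huA : u ∈ A := by
        have := hA h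
        tauto
      exact Finset.mem_filter.mpr ⟨Finset.mem_univ _, huA, fun hu => hI.1 (hfmem j).1 hu h⟩)
  exact hxv (congrFun hzero ⟨v, hvA, hvI⟩)

lemma mem_supp_of_forall_mem (hA : ∀ ⦃u v : V⦄, G.Adj u v → (u ∈ A ↔ v ∉ A)) (hc : C4kFree G)
    {v : V} (hvA : v ∈ A) (hv : ∀ s, IsMaxIndep G s → v ∈ s) : v ∈ supp G := by
  obtain ⟨I, hI⟩ := exists_isMaxIndep G
  let S := {u : V // u ∉ A ∧ u ∉ I}
  obtain ⟨f, hf, hfmem⟩ := (Finset.all_card_le_biUnion_card_iff_exists_injective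
    (fun w : S => (Finset.univ.filter fun u => u ∈ I ∧ G.Adj w u).erase v)).mp (by
      intro T
      have h := hI.card_le_card_erase_nbrsIn hv (T := T.map (Function.Embedding.subtype _))
        (isIndep_of_subset (bipartition_compl hA) (by
          intro u hu
          obtain ⟨w, -, rfl⟩ := Finset.mem_map.mp hu
          exact w.2.1)) (by
          intro u hu
          obtain ⟨w, -, rfl⟩ := Finset.mem_map.mp hu
          exact w.2.2)
      rw [Finset.card_map] at h
      refine h.trans_eq (congrArg _ ?_)
      ext u
      simp only [mem_nbrsIn, Finset.mem_map, Finset.mem_biUnion, Finset.mem_filter,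
        Finset.mem_univ, true_and, Function.Embedding.subtype_apply, Finset.mem_erase]
      constructor
      · rintro ⟨h0, h1, _, ⟨w, hw, rfl⟩, h2⟩
        exact ⟨w, hw, h0, h1, h2⟩
      · rintro ⟨w, hw, h0, h1, h2⟩
        exact ⟨h0, h1, w, ⟨w, hw, rfl⟩, h2⟩)
  simp only [Finset.mem_erase, Finset.mem_filter, Finset.mem_univ, true_and] at hfmem
  have hdet := det_ne_zero_of_matching hc (a := fun w : S => (w : V)) (b := f)
    Subtype.val_injective hf
    (fun i j h => i.2.2 (h ▸ (hfmem j).2.1)) (fun i => (hfmem i).2.2)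
  obtain ⟨y, hy⟩ := (Matrix.mulVec_surjective_iff_isUnit.mpr
    ((Matrix.isUnit_iff_isUnit_det _).mpr hdet.isUnit))
    (fun w : S => if G.Adj w v then (-1 : ℝ) else 0)
  have hfA : ∀ j, f j ∈ A := fun j => by
    have := hA (hfmem j).2.2
    have := j.2.1
    tauto
  refine ⟨fun u => (if u = v then 1 else 0) + ∑ j, if f j = u then y j else 0, ?_, ?_⟩
  · rw [mem_nullSet_iff_s18]
    intro w
    have hsum : (∑ u, if G.Adj w u then
          ((if u = v then (1 : ℝ) else 0) + ∑ j, if f j = u then y j else 0) else 0) =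
        (if G.Adj w v then 1 else 0) + ∑ j, if G.Adj w (f j) then y j else 0 := by
      rw [← Finset.sum_filter, Finset.sum_add_distrib, Finset.sum_comm]
      simp
    rw [hsum]
    by_cases hw : w ∉ A ∧ w ∉ I
    · have := congrFun hy ⟨w, hw⟩
      simp only [Matrix.mulVec, dotProduct, Matrix.of_apply, ite_mul, one_mul, zero_mul] at this
      rw [this]
      split_ifs <;> simp
    · have hnot : ∀ u ∈ A, u ∈ I → ¬ G.Adj w u := by
        intro u huA huI h
        refine hw ⟨fun hwA => (hA h).mp hwA huA, fun hwI => hI.1 hwI huI h⟩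
      rw [if_neg (hnot v hvA (hv I hI)), zero_add]
      exact Finset.sum_eq_zero fun j _ => if_neg (hnot _ (hfA j) (hfmem j).2.1)
  · have : ∀ j, f j ≠ v := fun j => (hfmem j).1
    simp [this]

lemma mem_supp_iff_of_mem (hA : ∀ ⦃u v : V⦄, G.Adj u v → (u ∈ A ↔ v ∉ A)) (hc : C4kFree G)
    {v : V} (hvA : v ∈ A) : v ∈ supp G ↔ ∀ s, IsMaxIndep G s → v ∈ s :=
  ⟨fun h _ hs => mem_of_mem_supp hA hc hvA h hs, mem_supp_of_forall_mem hA hc hvA⟩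

lemma mem_supp_iff (hb : IsBipartite G) (hc : C4kFree G) {v : V} :
    v ∈ supp G ↔ ∀ s, IsMaxIndep G s → v ∈ s := by
  obtain ⟨A, hA⟩ := hb
  by_cases hvA : v ∈ A
  · exact mem_supp_iff_of_mem hA hc hvA
  · exact mem_supp_iff_of_mem (bipartition_compl hA) hc hvA

/-- The union of two independent sets on one side together with their intersection on the other
side is independent. -/
lemma isIndep_sup {W : Type*} {G : SimpleGraph W} {A : Set W}
    (hA : ∀ ⦃u v : W⦄, G.Adj u v → (u ∈ A ↔ v ∉ A)) {I J : Set W}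
    (hI : IsIndep G I) (hJ : IsIndep G J) : IsIndep G ((I ∪ J) ∩ A ∪ (I ∩ J) \ A) := by
  rintro u (⟨hu, huA⟩ | ⟨hu, huA⟩) w (⟨hw, hwA⟩ | ⟨hw, hwA⟩) h
  · exact (hA h).mp huA hwA
  · exact hu.elim (fun hu => hI hu hw.1 h) fun hu => hJ hu hw.2 h
  · exact hw.elim (fun hw => hI hu.1 hw h) fun hw => hJ hu.2 hw h
  · exact huA ((hA h).mpr hwA)

lemma isMaxIndep_sup {W : Type*} [Finite W] {G : SimpleGraph W} {A : Set W}
    (hA : ∀ ⦃u v : W⦄, G.Adj u v → (u ∈ A ↔ v ∉ A)) {I J : Set W}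
    (hI : IsMaxIndep G I) (hJ : IsMaxIndep G J) :
    IsMaxIndep G ((I ∪ J) ∩ A ∪ (I ∩ J) \ A) := by
  have h1 := isIndep_sup hA hI.1 hJ.1
  have h2 := hI.2 _ (isIndep_sup (bipartition_compl hA) hI.1 hJ.1)
  have hunion : ((I ∪ J) ∩ A ∪ (I ∩ J) \ A) ∪ ((I ∪ J) ∩ Aᶜ ∪ (I ∩ J) \ Aᶜ) = I ∪ J := by
    ext u
    simp only [Set.mem_union, Set.mem_inter_iff, Set.mem_sdiff, Set.mem_compl_iff]
    tauto
  have hinter : ((I ∪ J) ∩ A ∪ (I ∩ J) \ A) ∩ ((I ∪ J) ∩ Aᶜ ∪ (I ∩ J) \ Aᶜ) = I ∩ J := by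
    ext u
    simp only [Set.mem_union, Set.mem_inter_iff, Set.mem_sdiff, Set.mem_compl_iff]
    tauto
  have h3 := Set.ncard_union_add_ncard_inter ((I ∪ J) ∩ A ∪ (I ∩ J) \ A)
    ((I ∪ J) ∩ Aᶜ ∪ (I ∩ J) \ Aᶜ) (Set.toFinite _) (Set.toFinite _)
  have h4 := Set.ncard_union_add_ncard_inter I J (Set.toFinite _) (Set.toFinite _)
  rw [hunion, hinter] at h3
  refine ⟨h1, fun t ht => ?_⟩
  have := hI.2 t ht
  have := hJ.2 t ht
  have := hJ.2 I hI.1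
  have := hI.2 J hJ.1
  omega

lemma exists_adj_forall_mem_of_mem {W : Type*} [Finite W] {G : SimpleGraph W} {A : Set W}
    (hA : ∀ ⦃u v : W⦄, G.Adj u v → (u ∈ A ↔ v ∉ A)) {u : W} (huA : u ∈ A)
    (hu : ∀ s, IsMaxIndep G s → u ∉ s) :
    ∃ v, G.Adj u v ∧ ∀ s, IsMaxIndep G s → v ∈ s := by
  by_contra! hcon
  obtain ⟨I, hI, hmin⟩ := Set.exists_min_image {s : Set W | IsMaxIndep G s}
    (fun s => (s ∩ {b | G.Adj u b}).ncard) (Set.toFinite _) (exists_isMaxIndep G)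
  have hempty : ∀ b ∈ I, ¬ G.Adj u b := by
    intro b hbI hub
    obtain ⟨J, hJ, hbJ⟩ := hcon b hub
    refine (hmin _ (isMaxIndep_sup hA hI hJ)).not_gt (Set.ncard_lt_ncard ?_ (Set.toFinite _))
    refine Set.ssubset_iff_of_subset ?_ |>.mpr ⟨b, ⟨hbI, hub⟩, ?_⟩
    · rintro c ⟨(⟨-, hcA⟩ | ⟨hc, -⟩), huc⟩
      · exact ((hA huc).mp huA hcA).elim
      · exact ⟨hc.1, huc⟩
    · rintro ⟨(⟨-, hbA⟩ | ⟨hb, -⟩), -⟩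
      · exact (hA hub).mp huA hbA
      · exact hbJ hb.2
  have hins : IsIndep G (insert u I) := by
    rintro a (rfl | ha) b (rfl | hb) h
    · exact G.loopless.irrefl _ h
    · exact hempty b hb h
    · exact hempty a ha h.symm
    · exact hI.1 ha hb h
  have := hI.2 _ hins
  rw [Set.ncard_insert_of_notMem (hu I hI) (Set.toFinite _)] at this
  omega

lemma mem_core_iff (hb : IsBipartite G) (hc : C4kFree G) {u : V} :
    u ∈ core G ↔ ∀ s, IsMaxIndep G s → u ∉ s := by
  constructor
  · rintro ⟨v, hv, huv⟩ s hs hus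
    exact hs.1 hus ((mem_supp_iff hb hc).mp hv s hs) huv
  · intro hu
    obtain ⟨v, huv, hv⟩ : ∃ v, G.Adj u v ∧ ∀ s, IsMaxIndep G s → v ∈ s := by
      obtain ⟨A, hA⟩ := hb
      by_cases huA : u ∈ A
      · exact exists_adj_forall_mem_of_mem hA huA hu
      · exact exists_adj_forall_mem_of_mem (bipartition_compl hA) huA hu
    exact ⟨v, (mem_supp_iff hb hc).mpr hv, huv⟩

end Bipartite

/-- the null decomposition coincides with Zito's decomposition by
maximum independent sets. -/
theorem stmt18 (G : SimpleGraph V) (hb : IsBipartite G) (hc : C4kFree G) :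
    supp G = {v : V | ∀ s : Set V, IsMaxIndep G s → v ∈ s} ∧
    core G = {v : V | ∀ s : Set V, IsMaxIndep G s → v ∉ s} ∧
    npart G = {v : V | (∃ s : Set V, IsMaxIndep G s ∧ v ∈ s) ∧
      (∃ s : Set V, IsMaxIndep G s ∧ v ∉ s)} := by
  refine ⟨Set.ext fun v => mem_supp_iff hb hc, Set.ext fun v => mem_core_iff hb hc,
    Set.ext fun v => ?_⟩
  rw [npart, Set.mem_compl_iff, Set.mem_union, mem_supp_iff hb hc, mem_core_iff hb hc]
  simp only [Set.mem_ofPred_eq]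
  push Not
  exact and_comm

end C4kPaper
end
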